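/- arXiv:1504.05257 — 3 statements merged into one kernel-verified Lean document; each statement's English description precedes it below -/
import Mathlib

section
/- Let L/k be a quadratic extension of number fields. There exists a constant C, depending on k and L, such that for all real x ≥ 2 the set of squarefree nonzero ideals 𝔡 of 𝓞_k with Φ(𝔡) ≤ x and such that no prime ideal divisor of 𝔡 splits in L, is finite and has cardinality at most C·x·(log x)^{-1/2}. (These ideals 𝔡 are exactly the possible finite discriminants of quaternion algebras over k admitting an embedding of L, so this bounds the number of quaternion algebras B over k with Φ(disc_f(B)) ≤ x into which L embeds.) -/
open NumberField

/-- A nonzero prime ideal `P` of `𝓞 k` splits in the extension `L/k` if there are two distinct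
(nonzero) prime ideals of `𝓞 L` lying above `P`. -/
def SplitsIn (k L : Type*) [Field k] [NumberField k] [Field L] [NumberField L]
    [Algebra k L] (P : Ideal (𝓞 k)) : Prop :=
  ∃ Q₁ Q₂ : Ideal (𝓞 L), Q₁ ≠ Q₂ ∧ Q₁.IsPrime ∧ Q₂.IsPrime ∧ Q₁ ≠ ⊥ ∧ Q₂ ≠ ⊥ ∧
    Q₁.comap (algebraMap (𝓞 k) (𝓞 L)) = P ∧ Q₂.comap (algebraMap (𝓞 k) (𝓞 L)) = P

/-- The multiplicative function `Φ(𝔞) = |𝔞|·∏_{𝔭 ∣ 𝔞}(1 − 1/|𝔭|)`, product over the distinct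
prime ideal divisors of `𝔞`. -/
noncomputable def Phi {k : Type*} [Field k] [NumberField k] (a : Ideal (𝓞 k)) : ℝ :=
  (Ideal.absNorm a : ℝ) *
    ∏ᶠ P ∈ {P : Ideal (𝓞 k) | P ≠ ⊥ ∧ P.IsPrime ∧ P ∣ a}, (1 - 1 / (Ideal.absNorm P : ℝ))

open Finset in
/-- Hyperbola-type step: a Chebyshev bound for the weights bounds the logarithmically weighted
count of products of distinct weights by a sum of reciprocals. -/
theorem card_filter_prod_le_mul_log_le {P : Type*} [DecidableEq P] {w : P → ℝ}
    (hw : ∀ p, 1 ≤ w p) {A : ℝ}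
    (hA : ∀ (S : Finset P) (y : ℝ), 1 ≤ y → (∀ p ∈ S, w p ≤ y) →
      ∑ p ∈ S, Real.log (w p) ≤ A * y) {x : ℝ} (hx : 1 ≤ x) (U : Finset P) :
    #{T ∈ U.powerset | ∏ p ∈ T, w p ≤ x} * Real.log x ≤
      (1 + A) * x * ∑ T ∈ U.powerset with ∏ p ∈ T, w p ≤ x, (∏ p ∈ T, w p)⁻¹ := by
  set R : Finset (Finset P) := {T ∈ U.powerset | ∏ p ∈ T, w p ≤ x} with hR
  have hw0 : ∀ p, 0 < w p := fun p => lt_of_lt_of_le one_pos (hw p)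
  have hW0 : ∀ T : Finset P, 0 < ∏ p ∈ T, w p := fun T => prod_pos fun p _ => hw0 p
  have hx0 : 0 < x := by linarith
  have hlog0 : ∀ p, 0 ≤ Real.log (w p) := fun p => Real.log_nonneg (hw p)
  have key : ∑ T ∈ R, ∑ p ∈ T, Real.log (w p) ≤
      ∑ T ∈ R, ∑ p ∈ U with w p ≤ x / ∏ q ∈ T, w q, Real.log (w p) := by
    rw [sum_sigma', sum_sigma']
    let f : (Σ _ : Finset P, P) → (Σ _ : Finset P, P) := fun a => ⟨a.1.erase a.2, a.2⟩
    have hinj : Set.InjOn f (R.sigma fun T => T : Finset (Σ _ : Finset P, P)) := by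
      rintro ⟨T, p⟩ h ⟨T', p'⟩ h' he
      simp only [coe_sigma, Set.mem_sigma_iff, mem_coe] at h h'
      simp only [f, Sigma.mk.injEq, heq_eq_eq] at he
      obtain ⟨he, rfl⟩ := he
      have : T = T' := by rw [← insert_erase h.2, he, insert_erase h'.2]
      rw [this]
    have h1 : ∑ a ∈ R.sigma fun T => T, Real.log (w a.2) =
        ∑ b ∈ (R.sigma fun T => T).image f, Real.log (w b.2) := by
      rw [sum_image hinj]
    rw [h1]
    refine sum_le_sum_of_subset_of_nonneg ?_ fun b _ _ => hlog0 _
    intro b hb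
    obtain ⟨⟨T, p⟩, ha, rfl⟩ := mem_image.1 hb
    simp only [mem_sigma, hR, mem_filter, mem_powerset] at ha
    obtain ⟨⟨hTU, hTx⟩, hp⟩ := ha
    have hmul := mul_prod_erase T w hp
    simp only [f, mem_sigma, hR, mem_filter, mem_powerset]
    refine ⟨⟨(erase_subset _ _).trans hTU, ?_⟩, hTU hp, ?_⟩
    · nlinarith [hw p, hW0 (T.erase p)]
    · rw [le_div_iff₀ (hW0 _), hmul]; exact hTx
  calc (#R : ℝ) * Real.log x
      = ∑ T ∈ R, (Real.log (x / ∏ p ∈ T, w p) + ∑ p ∈ T, Real.log (w p)) := by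
        rw [← nsmul_eq_mul, ← sum_const]
        refine sum_congr rfl fun T _ => ?_
        rw [Real.log_div hx0.ne' (hW0 T).ne', Real.log_prod fun p _ => (hw0 p).ne']
        ring
    _ ≤ ∑ T ∈ R, x / (∏ p ∈ T, w p) + ∑ T ∈ R, A * (x / ∏ p ∈ T, w p) := by
        rw [sum_add_distrib]
        refine add_le_add (sum_le_sum fun T _ => ?_) (key.trans (sum_le_sum fun T hT => ?_))
        · exact Real.log_le_self (div_pos hx0 (hW0 T)).le
        · refine hA _ _ ?_ fun p hp => (mem_filter.1 hp).2
          rw [one_le_div (hW0 T)]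
          exact (mem_filter.1 hT).2
    _ = _ := by
        rw [← mul_sum, mul_sum]
        simp only [div_eq_mul_inv, ← mul_sum]
        ring

open Finset in
/-- Rankin's trick applied to `card_filter_prod_le_mul_log_le`: if the Euler product of the weights
is `O((s - 1)^{-1/2})`, the products of distinct weights up to `x` number
`O(x (log x)^{-1/2})`. -/
theorem exists_card_le_of_prod_le {P : Type*} {w : P → ℝ} (hw : ∀ p, 1 ≤ w p) {A B δ : ℝ}
    (hA : ∀ (S : Finset P) (y : ℝ), 1 ≤ y → (∀ p ∈ S, w p ≤ y) →
      ∑ p ∈ S, Real.log (w p) ≤ A * y) (hδ : 0 < δ)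
    (hB : ∀ s, 1 < s → s < 1 + δ → ∀ S : Finset P,
      ∏ p ∈ S, (1 + w p ^ (-s)) ≤ B * (s - 1) ^ (-(1 / 2) : ℝ)) :
    ∃ C : ℝ, ∀ x : ℝ, 2 ≤ x → ∀ 𝒯 : Finset (Finset P), (∀ T ∈ 𝒯, ∏ p ∈ T, w p ≤ x) →
      (#𝒯 : ℝ) ≤ C * x * Real.log x ^ (-(1 / 2) : ℝ) := by
  classical
  have hA0 : 0 ≤ A := by simpa using hA ∅ 1 le_rfl (by simp)
  have hl2 : 0 < Real.log 2 := Real.log_pos one_lt_two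
  set c := δ * Real.log 2 / 2 with hc
  have hc0 : 0 < c := by positivity
  refine ⟨(1 + A) * (Real.exp c * (B * c ^ (-(1 / 2) : ℝ))), fun x hx 𝒯 h𝒯 => ?_⟩
  have hx0 : 0 < x := by linarith
  have hlx : Real.log 2 ≤ Real.log x := Real.log_le_log two_pos hx
  have hlx0 : 0 < Real.log x := hl2.trans_le hlx
  set s := 1 + c / Real.log x with hs
  have hs1 : 1 < s := by have := div_pos hc0 hlx0; linarith
  have hsδ : s < 1 + δ := by
    have : c / Real.log x < δ := by rw [div_lt_iff₀ hlx0]; nlinarith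
    linarith
  have hw0 : ∀ p, 0 < w p := fun p => lt_of_lt_of_le one_pos (hw p)
  have hW0 : ∀ T : Finset P, 0 < ∏ p ∈ T, w p := fun T => prod_pos fun p _ => hw0 p
  set U := 𝒯.biUnion id
  have hsub : 𝒯 ⊆ {T ∈ U.powerset | ∏ p ∈ T, w p ≤ x} := fun T hT =>
    mem_filter.2 ⟨mem_powerset.2 (subset_biUnion_of_mem id hT), h𝒯 T hT⟩
  have hsum : ∑ T ∈ U.powerset with ∏ p ∈ T, w p ≤ x, (∏ p ∈ T, w p)⁻¹ ≤
      Real.exp c * (B * (s - 1) ^ (-(1 / 2) : ℝ)) := by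
    calc ∑ T ∈ U.powerset with ∏ p ∈ T, w p ≤ x, (∏ p ∈ T, w p)⁻¹
        ≤ ∑ T ∈ U.powerset with ∏ p ∈ T, w p ≤ x, Real.exp c * (∏ p ∈ T, w p) ^ (-s) := by
          refine sum_le_sum fun T hT => ?_
          have hTx := (mem_filter.1 hT).2
          have h1 : (∏ p ∈ T, w p) ^ (s - 1) ≤ Real.exp c := by
            calc (∏ p ∈ T, w p) ^ (s - 1) ≤ x ^ (s - 1) :=
                  Real.rpow_le_rpow (hW0 T).le hTx (by linarith)
              _ = Real.exp c := by
                  rw [Real.rpow_def_of_pos hx0, hs]; congr 1; field_simp; ring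
          have h2 : (∏ p ∈ T, w p)⁻¹ = (∏ p ∈ T, w p) ^ (s - 1) * (∏ p ∈ T, w p) ^ (-s) := by
            rw [← Real.rpow_add (hW0 T), ← Real.rpow_neg_one]; congr 1; ring
          rw [h2]
          exact mul_le_mul_of_nonneg_right h1 (Real.rpow_nonneg (hW0 T).le _)
      _ ≤ ∑ T ∈ U.powerset, Real.exp c * (∏ p ∈ T, w p) ^ (-s) :=
          sum_le_sum_of_subset_of_nonneg (filter_subset _ _) fun T _ _ =>
            mul_nonneg (Real.exp_pos _).le (Real.rpow_nonneg (hW0 T).le _)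
      _ = Real.exp c * ∏ p ∈ U, (1 + w p ^ (-s)) := by
          rw [prod_one_add, mul_sum]
          refine sum_congr rfl fun T _ => ?_
          rw [Real.finsetProd_rpow _ _ fun p _ => (hw0 p).le]
      _ ≤ _ := by gcongr; exact hB s hs1 hsδ U
  have hmain := card_filter_prod_le_mul_log_le hw hA (by linarith : 1 ≤ x) U
  have hcard : (#𝒯 : ℝ) ≤ #{T ∈ U.powerset | ∏ p ∈ T, w p ≤ x} := by
    exact_mod_cast card_le_card hsub
  have hsc : (s - 1) ^ (-(1 / 2) : ℝ) =
      c ^ (-(1 / 2) : ℝ) * (Real.log x ^ (-(1 / 2) : ℝ) * Real.log x) := by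
    have h2 : Real.log x ^ (-(1 / 2) : ℝ) * Real.log x = Real.log x ^ (1 / 2 : ℝ) := by
      nth_rewrite 2 [← Real.rpow_one (Real.log x)]
      rw [← Real.rpow_add hlx0]; norm_num
    rw [h2, hs, add_sub_cancel_left, Real.div_rpow hc0.le hlx0.le, Real.rpow_neg hlx0.le,
      div_inv_eq_mul]
  refine le_of_mul_le_mul_right ?_ hlx0
  calc (#𝒯 : ℝ) * Real.log x ≤ _ := mul_le_mul_of_nonneg_right hcard hlx0.le
    _ ≤ _ := hmain
    _ ≤ (1 + A) * x * (Real.exp c * (B * (s - 1) ^ (-(1 / 2) : ℝ))) :=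
        mul_le_mul_of_nonneg_left hsum (by positivity)
    _ = _ := by rw [hsc]; ring

open Filter Topology in
/-- The Dirichlet series over all ideals converges to the Dedekind zeta function wherever the
latter does not vanish. -/
theorem hasSum_absNorm_rpow (K : Type*) [Field K] [NumberField K] {s : ℝ} (hs : s ≠ 0)
    (hζ : dedekindZeta K s ≠ 0) :
    HasSum (fun I : Ideal (𝓞 K) => (Ideal.absNorm I : ℝ) ^ (-s)) (dedekindZeta K s).re := by
  have hsum : LSeriesSummable (fun n => Nat.card {I : Ideal (𝓞 K) // Ideal.absNorm I = n}) s := by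
    by_contra h
    exact hζ (LSeries.eq_zero_of_not_LSeriesSummable _ _ h)
  have h1 : HasSum (fun n : ℕ =>
      (Nat.card {I : Ideal (𝓞 K) // Ideal.absNorm I = n} : ℝ) * (n : ℝ) ^ (-s))
      (dedekindZeta K s).re := by
    refine (Complex.hasSum_re hsum.LSeriesHasSum).congr_fun ?_
    intro n
    rcases eq_or_ne n 0 with rfl | hn
    · simp [Real.zero_rpow (neg_ne_zero.2 hs)]
    · rw [LSeries.term_of_ne_zero hn, Real.rpow_neg n.cast_nonneg, ← div_eq_mul_inv,
        ← Complex.ofReal_natCast n, ← Complex.ofReal_cpow n.cast_nonneg,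
        ← Complex.ofReal_natCast, ← Complex.ofReal_div, Complex.ofReal_re]
  rw [← (Equiv.sigmaFiberEquiv (Ideal.absNorm : Ideal (𝓞 K) → ℕ)).hasSum_iff]
  have hfib : ∀ n : ℕ, HasSum (fun I : {I : Ideal (𝓞 K) // Ideal.absNorm I = n} =>
      (Ideal.absNorm I.1 : ℝ) ^ (-s))
      ((Nat.card {I : Ideal (𝓞 K) // Ideal.absNorm I = n} : ℝ) * (n : ℝ) ^ (-s)) := by
    intro n
    have : Finite {I : Ideal (𝓞 K) // Ideal.absNorm I = n} := Ideal.finite_setOfPred_absNorm_eq n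
    have := Fintype.ofFinite {I : Ideal (𝓞 K) // Ideal.absNorm I = n}
    convert hasSum_fintype fun I : {I : Ideal (𝓞 K) // Ideal.absNorm I = n} =>
      (Ideal.absNorm I.1 : ℝ) ^ (-s)
    rw [Finset.sum_congr rfl fun I _ => by rw [I.2]]
    simp
  refine HasSum.sigma_of_hasSum h1 hfib ?_
  rw [summable_sigma_of_nonneg]
  · exact ⟨fun n => (hfib n).summable, h1.summable.congr fun n => ((hfib n).tsum_eq).symm⟩
  · intro a; exact Real.rpow_nonneg (Nat.cast_nonneg _) _

open Filter Topology in
theorem exists_bounds_tsum_absNorm_rpow (K : Type*) [Field K] [NumberField K] :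
    ∃ c > 0, ∃ C > 0, ∀ᶠ s : ℝ in 𝓝[>] 1,
      Summable (fun I : Ideal (𝓞 K) => (Ideal.absNorm I : ℝ) ^ (-s)) ∧
      c ≤ (s - 1) * ∑' I : Ideal (𝓞 K), (Ideal.absNorm I : ℝ) ^ (-s) ∧
      (s - 1) * ∑' I : Ideal (𝓞 K), (Ideal.absNorm I : ℝ) ^ (-s) ≤ C := by
  have hpos := dedekindZeta_residue_pos K
  set ρ := dedekindZeta_residue K
  have ht := tendsto_sub_one_mul_dedekindZeta_nhdsGT K
  have hre : Tendsto (fun s : ℝ => (s - 1) * (dedekindZeta K s).re) (𝓝[>] 1) (𝓝 ρ) := by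
    refine (((Complex.continuous_re.tendsto _).comp ht).congr fun s => ?_)
    simp only [Function.comp_apply]
    rw [← Complex.ofReal_one, ← Complex.ofReal_sub, Complex.re_ofReal_mul]
  refine ⟨ρ / 2, by positivity, 2 * ρ, by positivity, ?_⟩
  filter_upwards [hre.eventually_const_lt (half_lt_self hpos),
    hre.eventually_lt_const (by linarith : ρ < 2 * ρ), self_mem_nhdsWithin] with s h1 h2 h3
  have hs : (1 : ℝ) < s := h3
  have hne : dedekindZeta K s ≠ 0 := by
    intro h
    rw [h] at h1
    simp at h1
    linarith
  have := hasSum_absNorm_rpow K (by linarith : s ≠ 0) hne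
  exact ⟨this.summable, by rw [this.tsum_eq]; exact h1.le, by rw [this.tsum_eq]; exact h2.le⟩

open IsDedekindDomain in
/-- Partial Euler products: the sum over the nonzero ideals with prime factors in `S`. -/
theorem hasSum_absNorm_rpow_of_factors_mem {K : Type*} [Field K] [NumberField K] {s : ℝ}
    (hs : 0 < s) (S : Finset (HeightOneSpectrum (𝓞 K))) :
    HasSum (fun I : {I : Ideal (𝓞 K) // I ≠ ⊥ ∧
        ∀ v : HeightOneSpectrum (𝓞 K), v.asIdeal ∣ I → v ∈ S} =>
      (Ideal.absNorm I.1 : ℝ) ^ (-s))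
      (∏ v ∈ S, (1 - (Ideal.absNorm v.asIdeal : ℝ) ^ (-s))⁻¹) := by
  classical
  induction S using Finset.induction_on with
  | empty =>
    rw [Finset.prod_empty]
    have hone : ∀ I : Ideal (𝓞 K), (I ≠ ⊥ ∧
        ∀ v : HeightOneSpectrum (𝓞 K), v.asIdeal ∣ I → v ∈ (∅ : Finset _)) → I = 1 := by
      rintro I ⟨h0, h⟩
      by_contra h1
      obtain ⟨P, hP, hdvd⟩ := WfDvdMonoid.exists_irreducible_factor
        (by rwa [Ideal.isUnit_iff, ← Ideal.one_eq_top]) h0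
      simpa using h ⟨P, Ideal.isPrime_of_prime hP.prime, hP.ne_zero⟩ hdvd
    have hmem : (1 : Ideal (𝓞 K)) ≠ ⊥ ∧
        ∀ v : HeightOneSpectrum (𝓞 K), v.asIdeal ∣ 1 → v ∈ (∅ : Finset _) :=
      ⟨one_ne_zero, fun v hv => absurd (isUnit_of_dvd_one hv) v.prime.not_isUnit⟩
    have : Unique {I : Ideal (𝓞 K) // I ≠ ⊥ ∧
        ∀ v : HeightOneSpectrum (𝓞 K), v.asIdeal ∣ I → v ∈ (∅ : Finset _)} :=
      ⟨⟨⟨1, hmem⟩⟩, fun I => Subtype.ext (hone I.1 I.2)⟩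
    convert hasSum_unique fun I : {I : Ideal (𝓞 K) // I ≠ ⊥ ∧
        ∀ v : HeightOneSpectrum (𝓞 K), v.asIdeal ∣ I → v ∈ (∅ : Finset _)} =>
      (Ideal.absNorm I.1 : ℝ) ^ (-s)
    rw [hone _ (default : {I : Ideal (𝓞 K) // I ≠ ⊥ ∧
      ∀ v : HeightOneSpectrum (𝓞 K), v.asIdeal ∣ I → v ∈ (∅ : Finset _)}).2]
    simp
  | insert v S hv ih =>
    rw [Finset.prod_insert hv]
    have hN : (1 : ℝ) < Ideal.absNorm v.asIdeal := by
      exact_mod_cast NumberField.HeightOneSpectrum.one_lt_absNorm v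
    have hgeom : HasSum (fun n : ℕ => ((Ideal.absNorm v.asIdeal : ℝ) ^ (-s)) ^ n)
        (1 - (Ideal.absNorm v.asIdeal : ℝ) ^ (-s))⁻¹ :=
      hasSum_geometric_of_lt_one (by positivity)
        (Real.rpow_lt_one_of_one_lt_of_neg hN (neg_lt_zero.2 hs))
    have hmul := hgeom.mul ih (hgeom.summable.mul_of_nonneg ih.summable
      (fun _ => by positivity) (fun _ => by positivity))
    let e : ℕ × {I : Ideal (𝓞 K) // I ≠ ⊥ ∧
          ∀ w : HeightOneSpectrum (𝓞 K), w.asIdeal ∣ I → w ∈ S} →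
        {I : Ideal (𝓞 K) // I ≠ ⊥ ∧
          ∀ w : HeightOneSpectrum (𝓞 K), w.asIdeal ∣ I → w ∈ insert v S} := fun a =>
      ⟨v.asIdeal ^ a.1 * a.2.1, mul_ne_zero (pow_ne_zero _ v.ne_bot) a.2.2.1, fun w hw => by
        rcases w.prime.dvd_or_dvd hw with h | h
        · rw [Finset.mem_insert]; left
          exact HeightOneSpectrum.ext
            (associated_iff_eq.1
              ((w.prime.dvd_prime_iff_associated v.prime).1 (w.prime.dvd_of_dvd_pow h)))
        · exact Finset.mem_insert_of_mem (a.2.2.2 w h)⟩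
    have hcancel : ∀ (n m : ℕ) (I J : Ideal (𝓞 K)), ¬ v.asIdeal ∣ I →
        v.asIdeal ^ n * I = v.asIdeal ^ m * J → m ≤ n := by
      intro n m I J hI h
      by_contra! hlt
      obtain ⟨d, rfl⟩ := Nat.exists_eq_add_of_lt hlt
      rw [add_assoc, pow_add, mul_assoc, mul_right_inj' (pow_ne_zero _ v.ne_bot)] at h
      exact hI (h ▸ (dvd_pow_self _ d.succ_ne_zero).mul_right _)
    have he : Function.Bijective e := by
      constructor
      · rintro ⟨n, I, hI⟩ ⟨m, J, hJ⟩ h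
        have h' : v.asIdeal ^ n * I = v.asIdeal ^ m * J := congrArg Subtype.val h
        have hnm : n = m := le_antisymm
          (hcancel m n J I (fun hd => hv (hJ.2 v hd)) h'.symm)
          (hcancel n m I J (fun hd => hv (hI.2 v hd)) h')
        subst hnm
        rw [mul_right_inj' (pow_ne_zero _ v.ne_bot)] at h'
        subst h'
        rfl
      · rintro ⟨I, h0, hI⟩
        obtain ⟨J, hJ, hIJ⟩ :=
          (FiniteMultiplicity.of_prime_left v.prime h0).exists_eq_pow_mul_and_not_dvd
        refine ⟨⟨multiplicity v.asIdeal I, J, ?_, fun w hw => ?_⟩, Subtype.ext hJ.symm⟩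
        · rintro rfl
          exact hIJ (dvd_zero _)
        · rcases Finset.mem_insert.1 (hI w (hJ ▸ hw.mul_left _)) with rfl | h
          · exact absurd hw hIJ
          · exact h
    rw [← (Equiv.ofBijective e he).hasSum_iff]
    refine hmul.congr_fun fun a => ?_
    simp only [Function.comp_apply, Equiv.ofBijective_apply, e, map_mul, map_pow, Nat.cast_mul,
      Nat.cast_pow]
    rw [Real.mul_rpow (by positivity) (by positivity), ← Real.rpow_natCast, ← Real.rpow_natCast,
      ← Real.rpow_mul (by positivity), ← Real.rpow_mul (by positivity), mul_comm (-s)]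

open IsDedekindDomain in
theorem prod_inv_one_sub_le_tsum {K : Type*} [Field K] [NumberField K] {s : ℝ} (hs : 0 < s)
    (hsum : Summable (fun I : Ideal (𝓞 K) => (Ideal.absNorm I : ℝ) ^ (-s)))
    (S : Finset (HeightOneSpectrum (𝓞 K))) :
    ∏ v ∈ S, (1 - (Ideal.absNorm v.asIdeal : ℝ) ^ (-s))⁻¹ ≤
      ∑' I : Ideal (𝓞 K), (Ideal.absNorm I : ℝ) ^ (-s) := by
  rw [← (hasSum_absNorm_rpow_of_factors_mem hs S).tsum_eq]
  exact hsum.tsum_subtype_le _ _ fun I => by positivity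

open IsDedekindDomain in
theorem tsum_le_of_prod_inv_one_sub_le {K : Type*} [Field K] [NumberField K] {s B : ℝ} (hs : 0 < s)
    (hsum : Summable (fun I : Ideal (𝓞 K) => (Ideal.absNorm I : ℝ) ^ (-s)))
    (hB : ∀ S : Finset (HeightOneSpectrum (𝓞 K)),
      ∏ v ∈ S, (1 - (Ideal.absNorm v.asIdeal : ℝ) ^ (-s))⁻¹ ≤ B) :
    ∑' I : Ideal (𝓞 K), (Ideal.absNorm I : ℝ) ^ (-s) ≤ B := by
  classical
  refine hsum.tsum_le_of_sum_le fun A => ?_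
  have hfin : ∀ I ∈ A.filter (· ≠ ⊥), {v : HeightOneSpectrum (𝓞 K) | v.asIdeal ∣ I}.Finite :=
    fun I hI => Ideal.finite_factors (Finset.mem_filter.1 hI).2
  have hfin2 : (⋃ I ∈ A.filter (· ≠ ⊥),
      {v : HeightOneSpectrum (𝓞 K) | v.asIdeal ∣ I}).Finite := Set.Finite.biUnion
    (Finset.finite_toSet _) hfin
  refine le_trans ?_ (hB hfin2.toFinset)
  have hS := hasSum_absNorm_rpow_of_factors_mem hs hfin2.toFinset
  have hsplit : ∑ I ∈ A, (Ideal.absNorm I : ℝ) ^ (-s) =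
      ∑ I ∈ A with I ≠ ⊥, (Ideal.absNorm I : ℝ) ^ (-s) := by
    refine (Finset.sum_filter_of_ne fun I _ h => ?_).symm
    rintro rfl
    simp [Real.zero_rpow (neg_ne_zero.2 hs.ne')] at h
  have hmem : ∀ I ∈ A.filter (· ≠ ⊥), I ≠ ⊥ ∧
      ∀ v : HeightOneSpectrum (𝓞 K), v.asIdeal ∣ I → v ∈ hfin2.toFinset := fun I hI =>
    ⟨(Finset.mem_filter.1 hI).2, fun v hv => hfin2.mem_toFinset.2 <| Set.mem_biUnion hI hv⟩
  rw [hsplit, ← Finset.sum_subtype_of_mem _ hmem]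
  exact sum_le_hasSum _ (fun _ _ => by positivity) hS

open IsDedekindDomain in
/-- Chebyshev's upper bound for prime ideals. -/
theorem sum_log_absNorm_le (K : Type*) [Field K] [NumberField K]
    (S : Finset (HeightOneSpectrum (𝓞 K))) {y : ℝ} (hy : 0 ≤ y)
    (hS : ∀ v ∈ S, (Ideal.absNorm v.asIdeal : ℝ) ≤ y) :
    ∑ v ∈ S, Real.log (Ideal.absNorm v.asIdeal) ≤
      Module.finrank ℤ (𝓞 K) * (Real.log 4 * y) := by
  classical
  let f : HeightOneSpectrum (𝓞 K) → ℕ := fun v => (Ideal.absNorm v.asIdeal).minFac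
  have hf : ∀ v ∈ S, f v ∈ (Finset.Ioc 0 ⌊y⌋₊).filter Nat.Prime := by
    intro v hv
    have h1 := NumberField.HeightOneSpectrum.one_lt_absNorm v
    refine Finset.mem_filter.2 ⟨Finset.mem_Ioc.2 ⟨Nat.minFac_pos _, ?_⟩,
      Nat.minFac_prime h1.ne'⟩
    exact (Nat.minFac_le (by omega)).trans (Nat.le_floor (hS v hv))
  have hmem : ∀ v : HeightOneSpectrum (𝓞 K), ((f v : ℕ) : 𝓞 K) ∈ v.asIdeal := by
    intro v
    have : v.asIdeal.IsMaximal := v.isMaximal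
    obtain ⟨p, n, -, hpv, hp, hn⟩ := Ideal.exists_prime_and_absNorm_eq_pow v.asIdeal
    have hfv : f v = p := by
      simp only [f, hn]
      rw [Nat.pow_minFac, hp.minFac_eq]
      rintro rfl
      have := NumberField.HeightOneSpectrum.one_lt_absNorm v
      simp [hn] at this
    rwa [hfv]
  rw [← Finset.sum_fiberwise_of_maps_to hf]
  have hfib : ∀ p ∈ (Finset.Ioc 0 ⌊y⌋₊).filter Nat.Prime,
      ∑ v ∈ S with f v = p, Real.log (Ideal.absNorm v.asIdeal) ≤
        Module.finrank ℤ (𝓞 K) * Real.log p := by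
    intro p hp
    have hpp := (Finset.mem_filter.1 hp).2
    rw [← Real.log_prod fun v _ => by
      exact_mod_cast (zero_lt_one.trans (NumberField.HeightOneSpectrum.one_lt_absNorm v)).ne',
      ← Real.log_pow]
    have hdvd : ∏ v ∈ S with f v = p, v.asIdeal ∣ Ideal.span {(p : 𝓞 K)} := by
      rw [← Finset.prod_image (s := S.filter (f · = p)) (f := fun I : Ideal (𝓞 K) => I)
        (g := HeightOneSpectrum.asIdeal) fun v _ w _ h => HeightOneSpectrum.ext h]
      refine Finset.prod_primes_dvd _ ?_ ?_
      · intro I hI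
        obtain ⟨v, -, rfl⟩ := Finset.mem_image.1 hI
        exact v.prime
      · intro I hI
        obtain ⟨v, hv, rfl⟩ := Finset.mem_image.1 hI
        rw [Ideal.dvd_span_singleton, ← (Finset.mem_filter.1 hv).2]
        exact hmem v
    have hnorm := map_dvd Ideal.absNorm hdvd
    rw [map_prod, Ideal.absNorm_span_natCast] at hnorm
    have hle := Nat.le_of_dvd (pow_pos hpp.pos _) hnorm
    refine Real.log_le_log (Finset.prod_pos fun v _ => ?_) (by exact_mod_cast hle)
    exact_mod_cast (zero_lt_one.trans (NumberField.HeightOneSpectrum.one_lt_absNorm v))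
  refine (Finset.sum_le_sum hfib).trans ?_
  rw [← Finset.mul_sum]
  exact mul_le_mul_of_nonneg_left (Chebyshev.theta_le_log4_mul_x hy) (Nat.cast_nonneg _)

open IsDedekindDomain in
theorem absNorm_under_le {k L : Type*} [Field k] [NumberField k] [Field L] [NumberField L]
    [Algebra k L] (w : HeightOneSpectrum (𝓞 L)) :
    Ideal.absNorm (w.under (𝓞 k)).asIdeal ≤ Ideal.absNorm w.asIdeal := by
  have : w.asIdeal.LiesOver (w.under (𝓞 k)).asIdeal := ⟨rfl⟩
  have := w.isPrime
  rw [← Ideal.absNorm_pow_inertiaDeg (w.under (𝓞 k)).asIdeal w.asIdeal]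
  exact Nat.le_self_pow (Ideal.inertiaDeg_pos _ _).ne' _

open IsDedekindDomain in
theorem prod_absNorm_le_of_under_eq {k L : Type*} [Field k] [NumberField k] [Field L]
    [NumberField L] [Algebra k L] (v : HeightOneSpectrum (𝓞 k))
    (W : Finset (HeightOneSpectrum (𝓞 L))) (hW : ∀ w ∈ W, w.under (𝓞 k) = v) :
    ∏ w ∈ W, Ideal.absNorm w.asIdeal ≤ Ideal.absNorm v.asIdeal ^ Module.finrank k L := by
  classical
  have hdvd : ∏ w ∈ W, w.asIdeal ∣ v.asIdeal.map (algebraMap (𝓞 k) (𝓞 L)) := by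
    rw [← Finset.prod_image (s := W) (f := fun I : Ideal (𝓞 L) => I)
      (g := HeightOneSpectrum.asIdeal) fun v _ w _ h => HeightOneSpectrum.ext h]
    refine Finset.prod_primes_dvd _ ?_ ?_
    · intro I hI
      obtain ⟨v, -, rfl⟩ := Finset.mem_image.1 hI
      exact v.prime
    · intro I hI
      obtain ⟨w, hw, rfl⟩ := Finset.mem_image.1 hI
      rw [← hW w hw, Ideal.dvd_iff_le]
      exact Ideal.map_comap_le
  have hnorm := map_dvd Ideal.absNorm hdvd
  rw [map_prod, Ideal.absNorm_algebraMap, ← IsFractionRing.finrank_eq (𝓞 k) k (𝓞 L) L] at hnorm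
  have hpos := zero_lt_one.trans (NumberField.HeightOneSpectrum.one_lt_absNorm v)
  exact Nat.le_of_dvd (pow_pos hpos _) hnorm

open IsDedekindDomain in
theorem card_le_finrank_of_under_eq {k L : Type*} [Field k] [NumberField k] [Field L]
    [NumberField L] [Algebra k L] (v : HeightOneSpectrum (𝓞 k))
    (W : Finset (HeightOneSpectrum (𝓞 L))) (hW : ∀ w ∈ W, w.under (𝓞 k) = v) :
    W.card ≤ Module.finrank k L := by
  refine (Nat.pow_le_pow_iff_right (NumberField.HeightOneSpectrum.one_lt_absNorm v)).1
    (le_trans ?_ (prod_absNorm_le_of_under_eq v W hW))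
  rw [← Finset.prod_const]
  exact Finset.prod_le_prod' fun w hw => hW w hw ▸ absNorm_under_le w

open IsDedekindDomain in
theorem splitsIn_of_under_eq {k L : Type*} [Field k] [NumberField k] [Field L]
    [NumberField L] [Algebra k L] {w w' : HeightOneSpectrum (𝓞 L)} (hne : w ≠ w')
    (h : w.under (𝓞 k) = w'.under (𝓞 k)) : SplitsIn k L (w'.under (𝓞 k)).asIdeal :=
  ⟨w.asIdeal, w'.asIdeal, fun h' => hne (HeightOneSpectrum.ext h'), w.isPrime, w'.isPrime,
    w.ne_bot, w'.ne_bot, congrArg HeightOneSpectrum.asIdeal h, rfl⟩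

open IsDedekindDomain in
/-- Outside finitely many (ramified) primes, a prime of `k` that does not split in the quadratic
extension `L` is inert. -/
theorem exists_finset_forall_sq_absNorm_le (k L : Type*) [Field k] [NumberField k] [Field L]
    [NumberField L] [Algebra k L] (hdeg : Module.finrank k L = 2) :
    ∃ R : Finset (HeightOneSpectrum (𝓞 k)), ∀ w : HeightOneSpectrum (𝓞 L),
      ¬ SplitsIn k L (w.under (𝓞 k)).asIdeal → w.under (𝓞 k) ∉ R →
      Ideal.absNorm (w.under (𝓞 k)).asIdeal ^ 2 ≤ Ideal.absNorm w.asIdeal := by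
  classical
  have hfin : {w : HeightOneSpectrum (𝓞 L) |
      w.asIdeal ∣ differentIdeal (𝓞 k) (𝓞 L)}.Finite :=
    Ideal.finite_factors differentIdeal_ne_bot
  refine ⟨hfin.toFinset.image (·.under (𝓞 k)), fun w hsplit hR => ?_⟩
  set v := w.under (𝓞 k) with hv
  have : w.asIdeal.LiesOver v.asIdeal := ⟨rfl⟩
  have := w.isPrime
  have hN := Ideal.absNorm_pow_inertiaDeg v.asIdeal w.asIdeal
  have h1 := NumberField.HeightOneSpectrum.one_lt_absNorm v
  by_contra! hlt
  rw [← hN, Nat.pow_lt_pow_iff_right h1] at hlt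
  have hpos := Ideal.inertiaDeg_pos w.asIdeal (𝓞 k)
  have hf : w.asIdeal.inertiaDeg (𝓞 k) = 1 := by omega
  rw [hf, pow_one] at hN
  have hdvd : w.asIdeal ∣ v.asIdeal.map (algebraMap (𝓞 k) (𝓞 L)) := by
    rw [Ideal.dvd_iff_le]; exact Ideal.map_comap_le
  obtain ⟨J, hJ⟩ := hdvd
  have hNJ := congrArg Ideal.absNorm hJ
  rw [Ideal.absNorm_algebraMap, ← IsFractionRing.finrank_eq (𝓞 k) k (𝓞 L) L, hdeg, map_mul, ← hN,
    sq] at hNJ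
  have hNJ' := Nat.eq_of_mul_eq_mul_left (by omega) hNJ
  have hJ0 : J ≠ 0 := by
    rintro rfl
    simp at hNJ'
    omega
  have hJ1 : ¬ IsUnit J := by
    rw [Ideal.isUnit_iff, ← Ideal.absNorm_eq_one_iff]
    omega
  obtain ⟨P, hP, hPJ⟩ := WfDvdMonoid.exists_irreducible_factor hJ1 hJ0
  let w' : HeightOneSpectrum (𝓞 L) := ⟨P, Ideal.isPrime_of_prime hP.prime, hP.ne_zero⟩
  have hw' : w'.under (𝓞 k) = v := by
    have : v.asIdeal.IsMaximal := v.isMaximal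
    have h2 := (Ideal.liesOver_iff_dvd_map w'.isPrime.ne_top).2
      (hJ ▸ hPJ.mul_left _ : w'.asIdeal ∣ v.asIdeal.map (algebraMap (𝓞 k) (𝓞 L)))
    exact HeightOneSpectrum.ext h2.over.symm
  have hww : w' = w := by
    by_contra hne
    exact hsplit (splitsIn_of_under_eq hne hw')
  have hsq : w.asIdeal ^ 2 ∣ v.asIdeal.map (algebraMap (𝓞 k) (𝓞 L)) := by
    rw [hJ, sq]
    exact mul_dvd_mul_left _ (hww ▸ hPJ : w.asIdeal ∣ J)
  have : v.asIdeal.IsMaximal := v.isMaximal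
  have hd := pow_sub_one_dvd_differentIdeal (𝓞 k) w.asIdeal 2 v.ne_bot hsq
  rw [Nat.add_one_sub_one, pow_one] at hd
  exact hR (Finset.mem_image.2 ⟨w, hfin.mem_toFinset.2 hd, rfl⟩)

open IsDedekindDomain in
theorem prod_inv_one_sub_le_of_under_eq {k L : Type*} [Field k] [NumberField k] [Field L]
    [NumberField L] [Algebra k L] (hdeg : Module.finrank k L = 2) {s : ℝ} (hs : 0 < s)
    (v : HeightOneSpectrum (𝓞 k)) (W : Finset (HeightOneSpectrum (𝓞 L)))
    (hW : ∀ w ∈ W, w.under (𝓞 k) = v) :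
    ∏ w ∈ W, (1 - (Ideal.absNorm w.asIdeal : ℝ) ^ (-s))⁻¹ ≤
      (1 - (Ideal.absNorm v.asIdeal : ℝ) ^ (-s))⁻¹ ^ 2 := by
  have h1 : (1 : ℝ) < Ideal.absNorm v.asIdeal := by
    exact_mod_cast NumberField.HeightOneSpectrum.one_lt_absNorm v
  have ht0 : 0 < (Ideal.absNorm v.asIdeal : ℝ) ^ (-s) := by positivity
  have ht1 : (Ideal.absNorm v.asIdeal : ℝ) ^ (-s) < 1 :=
    Real.rpow_lt_one_of_one_lt_of_neg h1 (neg_lt_zero.2 hs)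
  have hle : ∀ w ∈ W, (Ideal.absNorm w.asIdeal : ℝ) ^ (-s) ≤
      (Ideal.absNorm v.asIdeal : ℝ) ^ (-s) := fun w hw =>
    Real.rpow_le_rpow_of_nonpos (by linarith)
      (by exact_mod_cast hW w hw ▸ absNorm_under_le (k := k) w) (by linarith)
  calc ∏ w ∈ W, (1 - (Ideal.absNorm w.asIdeal : ℝ) ^ (-s))⁻¹
      ≤ ∏ _w ∈ W, (1 - (Ideal.absNorm v.asIdeal : ℝ) ^ (-s))⁻¹ := by
        refine Finset.prod_le_prod (fun w hw => inv_nonneg.2 ?_) fun w hw => ?_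
        · linarith [hle w hw]
        · exact inv_anti₀ (by linarith) (by linarith [hle w hw])
    _ ≤ _ := by
        rw [Finset.prod_const]
        refine pow_le_pow_right₀ (one_le_inv_iff₀.2 ⟨by linarith, by linarith⟩) ?_
        exact hdeg ▸ card_le_finrank_of_under_eq v W hW

open IsDedekindDomain in
theorem sq_one_add_mul_prod_inv_one_sub_le {k L : Type*} [Field k] [NumberField k] [Field L]
    [NumberField L] [Algebra k L] [DecidableEq (HeightOneSpectrum (𝓞 k))]
    {R : Finset (HeightOneSpectrum (𝓞 k))}
    (hR : ∀ w : HeightOneSpectrum (𝓞 L),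
      ¬ SplitsIn k L (w.under (𝓞 k)).asIdeal → w.under (𝓞 k) ∉ R →
      Ideal.absNorm (w.under (𝓞 k)).asIdeal ^ 2 ≤ Ideal.absNorm w.asIdeal)
    {s : ℝ} (hs : 0 < s) (v : HeightOneSpectrum (𝓞 k)) (hv : ¬ SplitsIn k L v.asIdeal)
    (W : Finset (HeightOneSpectrum (𝓞 L))) (hW : ∀ w ∈ W, w.under (𝓞 k) = v) :
    (1 + (Ideal.absNorm v.asIdeal : ℝ) ^ (-s)) ^ 2 *
      ∏ w ∈ W, (1 - (Ideal.absNorm w.asIdeal : ℝ) ^ (-s))⁻¹ ≤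
      (if v ∈ R then 2 else 1) * (1 - (Ideal.absNorm v.asIdeal : ℝ) ^ (-s))⁻¹ ^ 2 := by
  have h1 : (1 : ℝ) < Ideal.absNorm v.asIdeal := by
    exact_mod_cast NumberField.HeightOneSpectrum.one_lt_absNorm v
  have ht0 : 0 < (Ideal.absNorm v.asIdeal : ℝ) ^ (-s) := by positivity
  have ht1 : (Ideal.absNorm v.asIdeal : ℝ) ^ (-s) < 1 :=
    Real.rpow_lt_one_of_one_lt_of_neg h1 (neg_lt_zero.2 hs)
  have hle : ∀ w ∈ W, (Ideal.absNorm w.asIdeal : ℝ) ^ (-s) ≤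
      (Ideal.absNorm v.asIdeal : ℝ) ^ (-s) := fun w hw =>
    Real.rpow_le_rpow_of_nonpos (by linarith)
      (by exact_mod_cast hW w hw ▸ absNorm_under_le (k := k) w) (by linarith)
  have hle2 : v ∉ R → ∀ w ∈ W, (Ideal.absNorm w.asIdeal : ℝ) ^ (-s) ≤
      ((Ideal.absNorm v.asIdeal : ℝ) ^ (-s)) ^ 2 := by
    intro hvR w hw
    have h2 := hR w (by rwa [hW w hw]) (by rwa [hW w hw])
    rw [hW w hw] at h2
    rw [← Real.rpow_natCast, ← Real.rpow_mul (by linarith), mul_comm, Real.rpow_mul (by linarith),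
      Real.rpow_natCast]
    exact Real.rpow_le_rpow_of_nonpos (by positivity) (by exact_mod_cast h2) (by linarith)
  set t := (Ideal.absNorm v.asIdeal : ℝ) ^ (-s)
  rw [inv_pow, ← div_eq_mul_inv, le_div_iff₀ (by nlinarith)]
  have hcard : W.card ≤ 1 := Finset.card_le_one.2 fun a ha b hb => by
    by_contra hne
    exact hv (hW b hb ▸ splitsIn_of_under_eq hne ((hW a ha).trans (hW b hb).symm))
  rcases Nat.le_one_iff_eq_zero_or_eq_one.1 hcard with h0 | h0
  · rw [Finset.card_eq_zero.1 h0, Finset.prod_empty]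
    have : (1 + t) ^ 2 * 1 * (1 - t) ^ 2 ≤ 1 := by
      have : (1 + t) ^ 2 * 1 * (1 - t) ^ 2 = (1 - t ^ 2) ^ 2 := by ring
      rw [this]
      exact pow_le_one₀ (by nlinarith) (by nlinarith)
    split_ifs <;> linarith
  · obtain ⟨w, rfl⟩ := Finset.card_eq_one.1 h0
    rw [Finset.prod_singleton]
    have hu := hle w (Finset.mem_singleton_self _)
    have hu2 : v ∉ R → _ := fun h => hle2 h w (Finset.mem_singleton_self _)
    set u := (Ideal.absNorm w.asIdeal : ℝ) ^ (-s)
    rw [mul_right_comm, ← div_eq_mul_inv, div_le_iff₀ (by linarith)]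
    have hrw : (1 + t) ^ 2 * (1 - t) ^ 2 = (1 - t ^ 2) * (1 - t ^ 2) := by ring
    split_ifs with hvR
    · have : (1 - t ^ 2) * (1 - t ^ 2) ≤ 1 * (2 * (1 - t)) :=
        mul_le_mul (by nlinarith) (by nlinarith) (by nlinarith) (by norm_num)
      rw [hrw]; linarith
    · have : (1 - t ^ 2) * (1 - t ^ 2) ≤ 1 * (1 - t ^ 2) :=
        mul_le_mul_of_nonneg_right (by nlinarith) (by nlinarith)
      rw [hrw]; linarith [hu2 hvR]

open IsDedekindDomain Filter Topology in
/-- The Euler product of the non-split primes of a quadratic extension is at most of order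
`(s - 1)^{-1/2}`, by comparison of the Dedekind zeta functions of both fields. -/
theorem exists_prod_one_add_absNorm_rpow_le (k L : Type*) [Field k] [NumberField k] [Field L]
    [NumberField L] [Algebra k L] (hdeg : Module.finrank k L = 2) :
    ∃ B > 0, ∀ᶠ s : ℝ in 𝓝[>] 1, ∀ S : Finset (HeightOneSpectrum (𝓞 k)),
      (∀ v ∈ S, ¬ SplitsIn k L v.asIdeal) →
      ∏ v ∈ S, (1 + (Ideal.absNorm v.asIdeal : ℝ) ^ (-s)) ≤ B * (s - 1) ^ (-(1 / 2) : ℝ) := by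
  classical
  obtain ⟨R, hR⟩ := exists_finset_forall_sq_absNorm_le k L hdeg
  obtain ⟨_, _, C, hC, hk⟩ := exists_bounds_tsum_absNorm_rpow k
  obtain ⟨c, hc, _, _, hL⟩ := exists_bounds_tsum_absNorm_rpow L
  refine ⟨√(2 ^ R.card * C ^ 2 / c), by positivity, ?_⟩
  filter_upwards [hk, hL, self_mem_nhdsWithin] with s ⟨hk1, _, hk2⟩ ⟨hL1, hL2, _⟩ hs1 S hS
  have hs1 : 1 < s := hs1
  have hs : 0 < s := by linarith
  set ζk := ∑' I : Ideal (𝓞 k), (Ideal.absNorm I : ℝ) ^ (-s)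
  set ζL := ∑' I : Ideal (𝓞 L), (Ideal.absNorm I : ℝ) ^ (-s)
  set D := ∏ v ∈ S, (1 + (Ideal.absNorm v.asIdeal : ℝ) ^ (-s)) with hD
  have hD0 : 0 < D := Finset.prod_pos fun v _ => by positivity
  have hpos (v : HeightOneSpectrum (𝓞 k)) :
      0 ≤ (1 - (Ideal.absNorm v.asIdeal : ℝ) ^ (-s))⁻¹ := by
    have h1 : (1 : ℝ) < Ideal.absNorm v.asIdeal := by
      exact_mod_cast NumberField.HeightOneSpectrum.one_lt_absNorm v
    have := Real.rpow_lt_one_of_one_lt_of_neg h1 (neg_lt_zero.2 hs)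
    exact inv_nonneg.2 (by linarith)
  have hposL (w : HeightOneSpectrum (𝓞 L)) :
      0 ≤ (1 - (Ideal.absNorm w.asIdeal : ℝ) ^ (-s))⁻¹ := by
    have h1 : (1 : ℝ) < Ideal.absNorm w.asIdeal := by
      exact_mod_cast NumberField.HeightOneSpectrum.one_lt_absNorm w
    have := Real.rpow_lt_one_of_one_lt_of_neg h1 (neg_lt_zero.2 hs)
    exact inv_nonneg.2 (by linarith)
  have hW (W : Finset (HeightOneSpectrum (𝓞 L))) :
      D ^ 2 * ∏ w ∈ W, (1 - (Ideal.absNorm w.asIdeal : ℝ) ^ (-s))⁻¹ ≤ 2 ^ R.card * ζk ^ 2 := by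
    set S' := S ∪ W.image (·.under (𝓞 k))
    have hmaps : ∀ w ∈ W, w.under (𝓞 k) ∈ S' := fun w hw =>
      Finset.mem_union_right _ (Finset.mem_image_of_mem _ hw)
    have hDS : D ^ 2 = ∏ v ∈ S', if v ∈ S then (1 + (Ideal.absNorm v.asIdeal : ℝ) ^ (-s)) ^ 2
        else 1 := by
      rw [Finset.prod_ite_mem, Finset.inter_eq_right.2 Finset.subset_union_left, hD,
        Finset.prod_pow]
    calc D ^ 2 * ∏ w ∈ W, (1 - (Ideal.absNorm w.asIdeal : ℝ) ^ (-s))⁻¹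
        = ∏ v ∈ S', ((if v ∈ S then (1 + (Ideal.absNorm v.asIdeal : ℝ) ^ (-s)) ^ 2 else 1) *
            ∏ w ∈ W with w.under (𝓞 k) = v, (1 - (Ideal.absNorm w.asIdeal : ℝ) ^ (-s))⁻¹) := by
          rw [Finset.prod_mul_distrib, ← hDS, Finset.prod_fiberwise_of_maps_to hmaps]
      _ ≤ ∏ v ∈ S', ((if v ∈ R then 2 else 1) *
            (1 - (Ideal.absNorm v.asIdeal : ℝ) ^ (-s))⁻¹ ^ 2) := by
          refine Finset.prod_le_prod (fun v _ => mul_nonneg (by split_ifs <;> positivity)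
            (Finset.prod_nonneg fun w _ => hposL w)) fun v _ => ?_
          have hWv : ∀ w ∈ W.filter (·.under (𝓞 k) = v), w.under (𝓞 k) = v := fun w hw =>
            (Finset.mem_filter.1 hw).2
          by_cases hv : v ∈ S
          · rw [if_pos hv]
            exact sq_one_add_mul_prod_inv_one_sub_le hR hs v (hS v hv) _ hWv
          · rw [if_neg hv, one_mul]
            refine (prod_inv_one_sub_le_of_under_eq hdeg hs v _ hWv).trans
              (le_mul_of_one_le_left (sq_nonneg _) ?_)
            split_ifs <;> norm_num
      _ = 2 ^ (S' ∩ R).card * (∏ v ∈ S', (1 - (Ideal.absNorm v.asIdeal : ℝ) ^ (-s))⁻¹) ^ 2 := by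
          rw [Finset.prod_mul_distrib, Finset.prod_ite_mem, Finset.prod_const, Finset.prod_pow]
      _ ≤ 2 ^ R.card * ζk ^ 2 := by
          refine mul_le_mul ?_ ?_ (sq_nonneg _) (by positivity)
          · exact pow_le_pow_right₀ one_le_two (Finset.card_le_card Finset.inter_subset_right)
          · exact pow_le_pow_left₀ (Finset.prod_nonneg fun v _ => hpos v)
              (prod_inv_one_sub_le_tsum hs hk1 S') 2
  have hζ : D ^ 2 * ζL ≤ 2 ^ R.card * ζk ^ 2 := by
    rw [mul_comm, ← le_div_iff₀ (by positivity)]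
    refine tsum_le_of_prod_inv_one_sub_le hs hL1 fun W => ?_
    rw [le_div_iff₀ (by positivity), mul_comm]
    exact hW W
  have hζk0 : 0 ≤ ζk := tsum_nonneg fun I => by positivity
  have hr : 0 < s - 1 := by linarith
  have hmain : D ^ 2 ≤ 2 ^ R.card * C ^ 2 / c * (s - 1)⁻¹ := by
    rw [div_mul_eq_mul_div, ← div_eq_mul_inv, le_div_iff₀ hc, le_div_iff₀ hr]
    calc D ^ 2 * c * (s - 1) ≤ D ^ 2 * ((s - 1) * ζL) * (s - 1) := by gcongr
      _ = (D ^ 2 * ζL) * (s - 1) ^ 2 := by ring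
      _ ≤ 2 ^ R.card * ζk ^ 2 * (s - 1) ^ 2 := by gcongr
      _ = 2 ^ R.card * ((s - 1) * ζk) ^ 2 := by ring
      _ ≤ 2 ^ R.card * C ^ 2 := by gcongr
  rw [Real.rpow_neg hr.le, ← Real.sqrt_eq_rpow, ← Real.sqrt_inv, ← Real.sqrt_mul (by positivity)]
  exact Real.le_sqrt_of_sq_le hmain

theorem one_add_sub_one_rpow_le {q s : ℝ} (hq : 2 ≤ q) (hs1 : 1 ≤ s) (hs2 : s ≤ 2) :
    1 + (q - 1) ^ (-s) ≤ (1 + q ^ (-s)) * (1 + 4 * q ^ (-2 : ℝ)) := by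
  have hq0 : 0 < q := by linarith
  have hq1 : 1 ≤ q - 1 := by linarith
  have hbern : 1 - s / q ≤ ((q - 1) / q) ^ s := by
    have := one_add_mul_self_le_rpow_one_add (s := -(1 / q)) (p := s)
      (by rw [neg_le_neg_iff, div_le_one hq0]; linarith) hs1
    convert this using 1
    · ring
    · congr 1; field_simp; ring
  have hdiff : (q - 1) ^ (-s) - q ^ (-s) ≤ 4 * q ^ (-2 : ℝ) := by
    have h1 : q ^ (-s) = (q - 1) ^ (-s) * ((q - 1) / q) ^ s := by
      rw [Real.div_rpow (by linarith) hq0.le, Real.rpow_neg hq0.le,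
        Real.rpow_neg (by linarith : 0 ≤ q - 1)]
      have : (q - 1) ^ s ≠ 0 := (Real.rpow_pos_of_pos (by linarith) s).ne'
      field_simp
    have h2 : (q - 1) ^ (-s) ≤ 2 / q := by
      calc (q - 1) ^ (-s) ≤ (q - 1) ^ (-1 : ℝ) :=
            Real.rpow_le_rpow_of_exponent_le hq1 (by linarith)
        _ = (q - 1)⁻¹ := Real.rpow_neg_one _
        _ ≤ 2 / q := by rw [inv_le_comm₀ (by linarith) (by positivity), inv_div]; linarith
    calc (q - 1) ^ (-s) - q ^ (-s) = (q - 1) ^ (-s) * (1 - ((q - 1) / q) ^ s) := by rw [h1]; ring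
      _ ≤ (q - 1) ^ (-s) * (s / q) :=
          mul_le_mul_of_nonneg_left (by linarith) (Real.rpow_nonneg (by linarith) _)
      _ ≤ 2 / q * (2 / q) := by gcongr
      _ = 4 * q ^ (-2 : ℝ) := by
          rw [Real.rpow_neg hq0.le, show (2 : ℝ) = (2 : ℕ) by norm_num, Real.rpow_natCast]
          push_cast; field_simp; norm_num
  have h3 : 0 ≤ q ^ (-s) := by positivity
  have h4 : 0 ≤ q ^ (-2 : ℝ) := by positivity
  nlinarith [mul_nonneg h3 h4]

open IsDedekindDomain Filter Topology in
theorem exists_prod_one_add_absNorm_sub_one_rpow_le (k L : Type*) [Field k] [NumberField k]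
    [Field L] [NumberField L] [Algebra k L] (hdeg : Module.finrank k L = 2) :
    ∃ B, ∀ᶠ s : ℝ in 𝓝[>] 1, ∀ S : Finset (HeightOneSpectrum (𝓞 k)),
      (∀ v ∈ S, ¬ SplitsIn k L v.asIdeal) →
      ∏ v ∈ S, (1 + ((Ideal.absNorm v.asIdeal : ℝ) - 1) ^ (-s)) ≤
        B * (s - 1) ^ (-(1 / 2) : ℝ) := by
  obtain ⟨B, hB0, hB⟩ := exists_prod_one_add_absNorm_rpow_le k L hdeg
  obtain ⟨_, _, _, _, hk⟩ := exists_bounds_tsum_absNorm_rpow k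
  have hlt2 : ∀ᶠ s : ℝ in 𝓝[>] 1, s < 2 :=
    eventually_nhdsWithin_of_eventually_nhds (eventually_lt_nhds one_lt_two)
  obtain ⟨r, ⟨hr, -⟩, hr2⟩ := (hk.and hlt2).exists
  set Z := ∑' I : Ideal (𝓞 k), (Ideal.absNorm I : ℝ) ^ (-r)
  refine ⟨Real.exp (4 * Z) * B, ?_⟩
  filter_upwards [hB, hlt2, self_mem_nhdsWithin] with s hs hs2 hs1 S hS
  have hs1 : 1 < s := hs1
  have hq (v : HeightOneSpectrum (𝓞 k)) : (2 : ℝ) ≤ Ideal.absNorm v.asIdeal := by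
    exact_mod_cast NumberField.HeightOneSpectrum.one_lt_absNorm v
  have hZ : ∑ v ∈ S, (Ideal.absNorm v.asIdeal : ℝ) ^ (-2 : ℝ) ≤ Z := by
    classical
    calc ∑ v ∈ S, (Ideal.absNorm v.asIdeal : ℝ) ^ (-2 : ℝ)
        ≤ ∑ v ∈ S, (Ideal.absNorm v.asIdeal : ℝ) ^ (-r) := Finset.sum_le_sum fun v _ =>
          Real.rpow_le_rpow_of_exponent_le (by linarith [hq v]) (by linarith)
      _ = ∑ I ∈ S.image HeightOneSpectrum.asIdeal, (Ideal.absNorm I : ℝ) ^ (-r) := by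
          rw [Finset.sum_image fun v _ w _ h => HeightOneSpectrum.ext h]
      _ ≤ Z := hr.sum_le_tsum _ fun _ _ => by positivity
  calc ∏ v ∈ S, (1 + ((Ideal.absNorm v.asIdeal : ℝ) - 1) ^ (-s))
      ≤ ∏ v ∈ S, ((1 + (Ideal.absNorm v.asIdeal : ℝ) ^ (-s)) *
          Real.exp (4 * (Ideal.absNorm v.asIdeal : ℝ) ^ (-2 : ℝ))) := by
        refine Finset.prod_le_prod (fun v _ => ?_) fun v _ => ?_
        · have := Real.rpow_nonneg (by linarith [hq v] :
            0 ≤ (Ideal.absNorm v.asIdeal : ℝ) - 1) (-s)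
          linarith
        · refine (one_add_sub_one_rpow_le (hq v) hs1.le hs2.le).trans ?_
          refine mul_le_mul_of_nonneg_left ?_ (by positivity)
          rw [add_comm]
          exact Real.add_one_le_exp _
    _ = (∏ v ∈ S, (1 + (Ideal.absNorm v.asIdeal : ℝ) ^ (-s))) *
          Real.exp (4 * ∑ v ∈ S, (Ideal.absNorm v.asIdeal : ℝ) ^ (-2 : ℝ)) := by
        rw [Finset.prod_mul_distrib, ← Real.exp_sum, Finset.mul_sum]
    _ ≤ (B * (s - 1) ^ (-(1 / 2) : ℝ)) * Real.exp (4 * Z) := by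
        have : 0 ≤ (s - 1) ^ (-(1 / 2) : ℝ) := Real.rpow_nonneg (by linarith) _
        refine mul_le_mul (hs S hS) ?_ (Real.exp_pos _).le (by positivity)
        gcongr
    _ = _ := by ring

open IsDedekindDomain in
theorem Phi_prod {k : Type*} [Field k] [NumberField k] (T : Finset (HeightOneSpectrum (𝓞 k))) :
    Phi (∏ v ∈ T, v.asIdeal) = ∏ v ∈ T, ((Ideal.absNorm v.asIdeal : ℝ) - 1) := by
  classical
  have hset : {P : Ideal (𝓞 k) | P ≠ ⊥ ∧ P.IsPrime ∧ P ∣ ∏ v ∈ T, v.asIdeal} =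
      (T.image HeightOneSpectrum.asIdeal : Finset (Ideal (𝓞 k))) := by
    ext P
    simp only [Set.mem_ofPred_eq, Finset.coe_image, Set.mem_image, Finset.mem_coe]
    constructor
    · rintro ⟨h0, hP, hdvd⟩
      have hprime := Ideal.prime_of_isPrime h0 hP
      obtain ⟨v, hv, hPv⟩ := (hprime.dvd_finsetProd_iff _).1 hdvd
      exact ⟨v, hv, (associated_iff_eq.1 ((hprime.dvd_prime_iff_associated v.prime).1 hPv)).symm⟩
    · rintro ⟨v, hv, rfl⟩
      exact ⟨v.ne_bot, v.isPrime, Finset.dvd_prod_of_mem _ hv⟩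
  rw [Phi, hset, finprod_mem_coe_finset,
    Finset.prod_image fun v _ w _ h => HeightOneSpectrum.ext h, map_prod, Nat.cast_prod,
    ← Finset.prod_mul_distrib]
  refine Finset.prod_congr rfl fun v _ => ?_
  have : (Ideal.absNorm v.asIdeal : ℝ) ≠ 0 := by
    exact_mod_cast (zero_lt_one.trans (NumberField.HeightOneSpectrum.one_lt_absNorm v)).ne'
  field_simp

open IsDedekindDomain in
theorem exists_eq_prod_asIdeal_of_squarefree {k : Type*} [Field k] [NumberField k]
    {𝔡 : Ideal (𝓞 k)} (h0 : 𝔡 ≠ ⊥) (hsq : Squarefree 𝔡) :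
    ∃ T : Finset (HeightOneSpectrum (𝓞 k)), ∏ v ∈ T, v.asIdeal = 𝔡 := by
  classical
  have hfin : {v : HeightOneSpectrum (𝓞 k) | v.asIdeal ∣ 𝔡}.Finite := Ideal.finite_factors h0
  have hnodup := (UniqueFactorizationMonoid.squarefree_iff_nodup_normalizedFactors h0).1 hsq
  refine ⟨hfin.toFinset, ?_⟩
  have himg : hfin.toFinset.image HeightOneSpectrum.asIdeal =
      (UniqueFactorizationMonoid.normalizedFactors 𝔡).toFinset := by
    ext P
    rw [Finset.mem_image, Multiset.mem_toFinset, Ideal.mem_normalizedFactors_iff h0]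
    constructor
    · rintro ⟨v, hv, rfl⟩
      exact ⟨v.isPrime, Ideal.le_of_dvd (hfin.mem_toFinset.1 hv)⟩
    · rintro ⟨hP, hle⟩
      exact ⟨⟨P, hP, fun h => h0 (le_bot_iff.1 (h ▸ hle))⟩,
        hfin.mem_toFinset.2 (Ideal.dvd_iff_le.2 hle), rfl⟩
  rw [← Finset.prod_image (f := fun I : Ideal (𝓞 k) => I) (g := HeightOneSpectrum.asIdeal)
    fun v _ w _ h => HeightOneSpectrum.ext h, himg, Finset.prod_eq_multiset_prod,
    Multiset.toFinset_val, hnodup.dedup, Multiset.map_id',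
    UniqueFactorizationMonoid.prod_normalizedFactors_eq h0, normalize_eq]

/-- The number of squarefree ideals `𝔡` of `𝓞 k` with `Φ(𝔡) ≤ x` having no prime divisor split
in the quadratic extension `L/k` is `O_{k,L}(x·(log x)^{-1/2})`; these are exactly the possible
finite discriminants of quaternion algebras over `k` admitting an embedding of `L`. -/
theorem stmt_7 (k L : Type*) [Field k] [NumberField k] [Field L] [NumberField L]
    [Algebra k L] (hdeg : Module.finrank k L = 2) :
    ∃ C : ℝ, ∀ x : ℝ, 2 ≤ x →
      {𝔡 : Ideal (𝓞 k) | 𝔡 ≠ ⊥ ∧ Squarefree 𝔡 ∧ Phi 𝔡 ≤ x ∧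
          ∀ P : Ideal (𝓞 k), P.IsPrime → P ∣ 𝔡 → ¬ SplitsIn k L P}.Finite ∧
      ({𝔡 : Ideal (𝓞 k) | 𝔡 ≠ ⊥ ∧ Squarefree 𝔡 ∧ Phi 𝔡 ≤ x ∧
          ∀ P : Ideal (𝓞 k), P.IsPrime → P ∣ 𝔡 → ¬ SplitsIn k L P}.ncard : ℝ) ≤
        C * x * (Real.log x) ^ (-(1 / 2) : ℝ) := by
  classical
  let P := {v : IsDedekindDomain.HeightOneSpectrum (𝓞 k) // ¬ SplitsIn k L v.asIdeal}
  let w : P → ℝ := fun v => (Ideal.absNorm v.1.asIdeal : ℝ) - 1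
  have hw : ∀ v, 1 ≤ w v := fun v => by
    have : (2 : ℝ) ≤ Ideal.absNorm v.1.asIdeal := by
      exact_mod_cast NumberField.HeightOneSpectrum.one_lt_absNorm v.1
    simp only [w]
    linarith
  have hA : ∀ (S : Finset P) (y : ℝ), 1 ≤ y → (∀ v ∈ S, w v ≤ y) →
      ∑ v ∈ S, Real.log (w v) ≤ (Module.finrank ℤ (𝓞 k) * (Real.log 4 * 2)) * y := by
    intro S y hy hS
    have hcheb := sum_log_absNorm_le k (S.map (Function.Embedding.subtype _))
      (by linarith : 0 ≤ 2 * y) fun v hv => by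
        obtain ⟨u, hu, rfl⟩ := Finset.mem_map.1 hv
        have := hS u hu
        simp only [w] at this
        simp only [Function.Embedding.subtype_apply]
        linarith
    rw [Finset.sum_map] at hcheb
    calc ∑ v ∈ S, Real.log (w v) ≤ ∑ v ∈ S, Real.log (Ideal.absNorm v.1.asIdeal) :=
          Finset.sum_le_sum fun v _ =>
            Real.log_le_log (by linarith [hw v]) (by simp only [w]; linarith)
      _ ≤ _ := hcheb
      _ = _ := by ring
  obtain ⟨B, hB⟩ := exists_prod_one_add_absNorm_sub_one_rpow_le k L hdeg
  obtain ⟨u, hu1, hu⟩ := mem_nhdsGT_iff_exists_Ioo_subset.1 hB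
  have hu1 : 1 < u := hu1
  obtain ⟨C, hC⟩ := exists_card_le_of_prod_le hw hA (sub_pos.2 hu1) (B := B)
    fun s hs hsu S => by
      have := hu ⟨hs, by linarith⟩ (S.map (Function.Embedding.subtype _)) fun v hv => by
        obtain ⟨u, hu, rfl⟩ := Finset.mem_map.1 hv
        exact u.2
      rwa [Finset.prod_map] at this
  refine ⟨C, fun x hx => ?_⟩
  set A := {T : Finset P | ∏ v ∈ T, w v ≤ x} with hAdef
  have hbound : ∀ 𝒯 : Finset (Finset P), (𝒯 : Set (Finset P)) ⊆ A →
      𝒯.card ≤ ⌊C * x * Real.log x ^ (-(1 / 2) : ℝ)⌋₊ := fun 𝒯 h𝒯 =>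
    Nat.le_floor (hC x hx 𝒯 fun T hT => h𝒯 hT)
  have hAfin : A.Finite := by
    by_contra hinf
    obtain ⟨𝒯, h𝒯, hcard⟩ := Set.Infinite.exists_subset_card_eq hinf
      (⌊C * x * Real.log x ^ (-(1 / 2) : ℝ)⌋₊ + 1)
    have := hbound 𝒯 h𝒯
    omega
  have hsub : {𝔡 : Ideal (𝓞 k) | 𝔡 ≠ ⊥ ∧ Squarefree 𝔡 ∧ Phi 𝔡 ≤ x ∧
      ∀ P : Ideal (𝓞 k), P.IsPrime → P ∣ 𝔡 → ¬ SplitsIn k L P} ⊆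
      (fun T : Finset P => ∏ v ∈ T, v.1.asIdeal) '' A := by
    rintro 𝔡 ⟨h0, hsq, hPhi, hsplit⟩
    obtain ⟨T, rfl⟩ := exists_eq_prod_asIdeal_of_squarefree h0 hsq
    have hT : ∀ v ∈ T, ¬ SplitsIn k L v.asIdeal := fun v hv =>
      hsplit _ v.isPrime (Finset.dvd_prod_of_mem _ hv)
    refine ⟨T.subtype _, ?_, Finset.prod_subtype_of_mem (fun v => v.asIdeal) hT⟩
    rw [Phi_prod, ← Finset.prod_subtype_of_mem _ hT] at hPhi
    exact hPhi
  refine ⟨(hAfin.image _).subset hsub, ?_⟩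
  have h1 := (Set.ncard_le_ncard hsub (hAfin.image _)).trans (Set.ncard_image_le hAfin)
  rw [Set.ncard_eq_toFinset_card _ hAfin] at h1
  exact (Nat.cast_le.2 h1).trans (hC x hx _ fun T hT => hAfin.mem_toFinset.1 hT)
end

section
/- There is an absolute constant C such that for every quadratic number field K (a number field with [K : ℚ] = 2, with discriminant Δ_K) and every real x ≥ 3: the number of squarefree positive integers n ≤ x having no prime factor that splits in K is at most C·(x/(log x)^{1/2})·(|Δ_K|/φ(|Δ_K|))^{1/2}·∏_{p ≤ x} (1 − s_K(p)/p)^{1/2}, where the product runs over rational primes p ≤ x, φ is Euler's totient function, and s_K(p) = 1 if p splits in K, s_K(p) = −1 if p is inert in K (i.e. p𝓞_K is a prime ideal), and s_K(p) = 0 if p ramifies in K (i.e. p divides Δ_K). -/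
open NumberField

/-- A rational prime `p` splits in the number field `K` if there are two distinct (nonzero)
prime ideals of `𝓞 K` lying above `p`. -/
def RatPrimeSplits (K : Type*) [Field K] [NumberField K] (p : ℕ) : Prop :=
  ∃ Q₁ Q₂ : Ideal (𝓞 K), Q₁ ≠ Q₂ ∧ Q₁.IsPrime ∧ Q₂.IsPrime ∧ Q₁ ≠ ⊥ ∧ Q₂ ≠ ⊥ ∧
    Q₁.comap (algebraMap ℤ (𝓞 K)) = Ideal.span {(p : ℤ)} ∧
    Q₂.comap (algebraMap ℤ (𝓞 K)) = Ideal.span {(p : ℤ)}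

/-- A rational prime `p` is inert in the number field `K` if `p·𝓞 K` is a prime ideal. -/
def RatPrimeInert (K : Type*) [Field K] [NumberField K] (p : ℕ) : Prop :=
  (Ideal.span {(p : 𝓞 K)}).IsPrime

open Classical in
/-- `sK K p` is `1` if `p` splits in `K`, `−1` if `p` is inert in `K`, and `0` otherwise
(for primes, the remaining case is exactly that `p` ramifies, i.e. `p ∣ Δ_K`). -/
noncomputable def sK (K : Type*) [Field K] [NumberField K] (p : ℕ) : ℝ :=
  if RatPrimeSplits K p then 1 else if RatPrimeInert K p then -1 else 0

/-- Products of prime powers `p ^ (N / p)` over primes `p ≤ N` divide `N!`. -/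
lemma prod_primesLE_pow_div_dvd_factorial (N : ℕ) :
    ∏ p ∈ N.primesLE, p ^ (N / p) ∣ N.factorial := by
  zify
  refine Finset.prod_dvd_of_coprime ?_ ?_
  · intro p hp q hq hpq
    have hp' := Nat.prime_of_mem_primesLE hp
    have hq' := Nat.prime_of_mem_primesLE hq
    exact ((Nat.isCoprime_iff_coprime.mpr ((Nat.coprime_primes hp' hq').mpr hpq)).pow)
  · intro p hp
    have hp' := Nat.prime_of_mem_primesLE hp
    have hpN := Nat.le_of_mem_primesLE hp
    norm_cast
    rw [Nat.Prime.pow_dvd_factorial_iff hp' (Nat.lt_succ_self _)]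
    have h1 : 1 ∈ Finset.Ico 1 (Nat.log p N).succ := by
      simp [Nat.log_pos hp'.one_lt hpN]
    simpa using Finset.single_le_sum (f := fun i => N / p ^ i) (fun _ _ => Nat.zero_le _) h1

lemma sum_log_div_primesLE_le {N : ℕ} (hN : 1 ≤ N) :
    ∑ p ∈ N.primesLE, Real.log p / p ≤ 2 * Real.log N := by
  have h1 : ∏ p ∈ N.primesLE, p ^ (N / p) ≤ N ^ N :=
    (Nat.le_of_dvd (Nat.factorial_pos N) (prod_primesLE_pow_div_dvd_factorial N)).trans
      (Nat.factorial_le_pow N)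
  have h2 : ∑ p ∈ N.primesLE, ((N / p : ℕ) : ℝ) * Real.log p ≤ N * Real.log N := by
    have h3 : Real.log ((∏ p ∈ N.primesLE, p ^ (N / p) : ℕ) : ℝ) ≤ Real.log ((N ^ N : ℕ) : ℝ) := by
      apply Real.log_le_log
      · exact_mod_cast Finset.prod_pos fun p hp =>
          pow_pos (Nat.prime_of_mem_primesLE hp).pos _
      · exact_mod_cast h1
    push_cast at h3
    rw [Real.log_prod, Real.log_pow] at h3
    · simpa [Real.log_pow] using h3
    · intro p hp
      have := (Nat.prime_of_mem_primesLE hp).pos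
      positivity
  have hN0 : (0 : ℝ) < N := by exact_mod_cast hN
  refine le_of_mul_le_mul_left ?_ hN0
  calc (N : ℝ) * ∑ p ∈ N.primesLE, Real.log p / p
      = ∑ p ∈ N.primesLE, (N / p : ℝ) * Real.log p := by
        rw [Finset.mul_sum]; exact Finset.sum_congr rfl fun _ _ => by ring
    _ ≤ ∑ p ∈ N.primesLE, 2 * (((N / p : ℕ) : ℝ) * Real.log p) := by
        refine Finset.sum_le_sum fun p hp => ?_
        have hp' := Nat.prime_of_mem_primesLE hp
        have hpN := Nat.le_of_mem_primesLE hp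
        rw [← mul_assoc]
        refine mul_le_mul_of_nonneg_right ?_ (Real.log_natCast_nonneg p)
        have h4 : 1 ≤ N / p := Nat.div_pos hpN hp'.pos
        have h5 : N < p * (N / p + 1) := Nat.lt_mul_div_succ N hp'.pos
        have h6 : N ≤ 2 * (N / p) * p := by nlinarith
        have hp0 : (0 : ℝ) < p := by exact_mod_cast hp'.pos
        rw [div_le_iff₀ hp0]
        exact_mod_cast h6
    _ ≤ N * (2 * Real.log N) := by rw [← Finset.mul_sum]; linarith

/-- The real zeta series satisfies `ζ(s) ≤ 1 + 1 / (s - 1)` for `s > 1`. -/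
lemma tsum_one_div_nat_rpow_le {s : ℝ} (hs : 1 < s) :
    ∑' n : ℕ, (n : ℝ) ^ (-s) ≤ 1 + 1 / (s - 1) := by
  have hsum : Summable fun n : ℕ => (n : ℝ) ^ (-s) := Real.summable_nat_rpow.mpr (by linarith)
  have h := ZetaAsymptotics.zeta_limit_aux1 hs
  have h0 : 0 ≤ ZetaAsymptotics.termTSum s :=
    tsum_nonneg fun n => ZetaAsymptotics.term_nonneg _ _
  rw [hsum.tsum_eq_zero_add]
  have h1 : ((0 : ℕ) : ℝ) ^ (-s) = 0 := by
    rw [Nat.cast_zero, Real.zero_rpow]; linarith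
  have h2 : ∑' n : ℕ, ((n + 1 : ℕ) : ℝ) ^ (-s) = ∑' n : ℕ, 1 / (n + 1 : ℝ) ^ s := by
    refine tsum_congr fun n => ?_
    rw [Real.rpow_neg (by positivity)]; push_cast; rw [one_div]
  rw [h1, h2, zero_add]
  nlinarith

lemma prod_one_sub_rpow_inv_le {s : ℝ} (hs : 1 < s) (N : ℕ) :
    ∏ p ∈ N.primesLE, (1 - (p : ℝ) ^ (-s))⁻¹ ≤ 1 + 1 / (s - 1) := by
  have hsum : Summable fun n : ℕ => (n : ℝ) ^ (-s) := Real.summable_nat_rpow.mpr (by linarith)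
  let f : ℕ →*₀ ℝ :=
    { toFun := fun n => (n : ℝ) ^ (-s)
      map_zero' := by rw [Nat.cast_zero, Real.zero_rpow]; linarith
      map_one' := by simp
      map_mul' := fun m n => by
        rw [Nat.cast_mul, Real.mul_rpow (Nat.cast_nonneg _) (Nat.cast_nonneg _)] }
  have h := EulerProduct.prod_primesBelow_geometric_eq_tsum_smoothNumbers
    (f := (f : ℕ →* ℝ)) (by exact hsum) (N + 1)
  have h' : ∏ p ∈ N.primesLE, (1 - (p : ℝ) ^ (-s))⁻¹ =
    ∑' m : (N + 1).smoothNumbers, ((m : ℕ) : ℝ) ^ (-s) := h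
  rw [h']
  exact (Summable.tsum_subtype_le (fun n : ℕ => (n : ℝ) ^ (-s)) _ (fun n => by positivity) hsum).trans (tsum_one_div_nat_rpow_le hs)

lemma one_sub_inv_inv_le {s : ℝ} (hs : 1 < s) {p : ℕ} (hp : p.Prime) :
    (1 - (p : ℝ)⁻¹)⁻¹ ≤
      (1 - (p : ℝ) ^ (-s))⁻¹ * Real.exp (2 * (s - 1) * (Real.log p / p)) := by
  have hp2 : (2 : ℝ) ≤ p := by exact_mod_cast hp.two_le
  have hp0 : (0 : ℝ) < p := by linarith
  have hi : (p : ℝ)⁻¹ ≤ 1 / 2 := by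
    rw [one_div]; exact inv_anti₀ (by norm_num) hp2
  have hi0 : 0 < (p : ℝ)⁻¹ := by positivity
  set u := (s - 1) * Real.log p with hu
  have hu0 : 0 ≤ u := mul_nonneg (by linarith) (Real.log_natCast_nonneg p)
  have hps : (p : ℝ) ^ (-s) = (p : ℝ)⁻¹ * Real.exp (-u) := by
    rw [Real.rpow_def_of_pos hp0, ← Real.exp_log (inv_pos.mpr hp0), ← Real.exp_add, Real.log_inv]
    congr 1; rw [hu]; ring
  have he1 : 1 - u ≤ Real.exp (-u) := by linarith [Real.add_one_le_exp (-u)]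
  have he2 : Real.exp (-u) ≤ 1 := Real.exp_le_one_iff.mpr (by linarith)
  have he3 : 1 + 2 * u * (p : ℝ)⁻¹ ≤ Real.exp (2 * (s - 1) * (Real.log p / p)) := by
    have := Real.add_one_le_exp (2 * (s - 1) * (Real.log p / p))
    have h2 : 2 * (s - 1) * (Real.log p / p) = 2 * u * (p : ℝ)⁻¹ := by rw [hu]; ring
    rw [h2] at this ⊢; linarith
  have hlt : (p : ℝ) ^ (-s) < 1 := by rw [hps]; nlinarith [Real.exp_pos (-u)]
  rw [inv_mul_eq_div, le_div_iff₀ (by linarith), inv_mul_le_iff₀ (by linarith)]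
  calc 1 - (p : ℝ) ^ (-s) ≤ 1 - (p : ℝ)⁻¹ * (1 - u) := by
        rw [hps]; nlinarith
    _ ≤ (1 - (p : ℝ)⁻¹) * (1 + 2 * u * (p : ℝ)⁻¹) := by
        nlinarith [mul_nonneg (mul_nonneg hu0 hi0.le) (by linarith : 0 ≤ 1 - 2 * (p : ℝ)⁻¹)]
    _ ≤ _ := mul_le_mul_of_nonneg_left he3 (by linarith)

/-- The upper bound in Mertens' third theorem. -/
lemma prod_one_sub_inv_inv_le_log {x : ℝ} (hx : 3 ≤ x) :
    ∏ p ∈ ⌊x⌋₊.primesLE, (1 - (p : ℝ)⁻¹)⁻¹ ≤ 2 * Real.exp 4 * Real.log x := by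
  have hL : 1 ≤ Real.log x := by
    rw [Real.le_log_iff_exp_le (by linarith)]
    linarith [Real.exp_one_lt_d9]
  have hN : 1 ≤ ⌊x⌋₊ := Nat.le_floor (by norm_num; linarith)
  set s := 1 + 1 / Real.log x with hs
  have hs0 : s - 1 = 1 / Real.log x := by rw [hs]; ring
  have hs1 : 1 < s := by
    have : 0 < 1 / Real.log x := by positivity
    linarith
  have hlog : Real.log ⌊x⌋₊ ≤ Real.log x :=
    Real.log_le_log (by exact_mod_cast hN) (Nat.floor_le (by linarith))
  calc ∏ p ∈ ⌊x⌋₊.primesLE, (1 - (p : ℝ)⁻¹)⁻¹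
      ≤ ∏ p ∈ ⌊x⌋₊.primesLE,
          ((1 - (p : ℝ) ^ (-s))⁻¹ * Real.exp (2 * (s - 1) * (Real.log p / p))) := by
        refine Finset.prod_le_prod (fun p hp => ?_) fun p hp =>
          one_sub_inv_inv_le hs1 (Nat.prime_of_mem_primesLE hp)
        have := (Nat.prime_of_mem_primesLE hp).one_lt
        have : (1 : ℝ) < p := by exact_mod_cast this
        exact inv_nonneg.mpr (sub_nonneg.mpr (inv_le_one_of_one_le₀ this.le))
    _ = (∏ p ∈ ⌊x⌋₊.primesLE, (1 - (p : ℝ) ^ (-s))⁻¹) *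
          Real.exp (2 * (s - 1) * ∑ p ∈ ⌊x⌋₊.primesLE, Real.log p / p) := by
        rw [Finset.prod_mul_distrib, ← Real.exp_sum, Finset.mul_sum]
    _ ≤ (2 * Real.log x) * Real.exp 4 := by
        refine mul_le_mul ?_ ?_ (Real.exp_pos _).le (by linarith)
        · refine (prod_one_sub_rpow_inv_le hs1 _).trans ?_
          rw [hs0, one_div_one_div]; linarith
        · rw [Real.exp_le_exp, hs0]
          have h := (sum_log_div_primesLE_le hN).trans
            (mul_le_mul_of_nonneg_left hlog (by norm_num : (0:ℝ) ≤ 2))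
          rw [mul_one_div, div_mul_eq_mul_div, div_le_iff₀ (by linarith)]
          linarith
    _ = _ := by ring

open Classical in
/-- The squarefree `n ∈ [1, N]` all of whose prime factors satisfy `P`. -/
noncomputable def squarefreeWithFactors (P : ℕ → Prop) (N : ℕ) : Finset ℕ :=
  {n ∈ Finset.Icc 1 N | Squarefree n ∧ ∀ p : ℕ, p.Prime → p ∣ n → P p}

lemma mem_squarefreeWithFactors {P : ℕ → Prop} {N n : ℕ} :
    n ∈ squarefreeWithFactors P N ↔
      (1 ≤ n ∧ n ≤ N) ∧ Squarefree n ∧ ∀ p : ℕ, p.Prime → p ∣ n → P p := by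
  simp [squarefreeWithFactors]

lemma sum_inv_squarefreeWithFactors_le (P : ℕ → Prop) [DecidablePred P] (N : ℕ) :
    ∑ n ∈ squarefreeWithFactors P N, (n : ℝ)⁻¹ ≤
      ∏ p ∈ N.primesLE with P p, (1 + (p : ℝ)⁻¹) := by
  rw [Finset.prod_one_add]
  have hinj : Set.InjOn Nat.primeFactors (squarefreeWithFactors P N : Set ℕ) := by
    intro m hm n hn h
    rw [← Nat.prod_primeFactors_of_squarefree (mem_squarefreeWithFactors.mp hm).2.1,
      ← Nat.prod_primeFactors_of_squarefree (mem_squarefreeWithFactors.mp hn).2.1, h]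
  calc ∑ n ∈ squarefreeWithFactors P N, (n : ℝ)⁻¹
      = ∑ n ∈ squarefreeWithFactors P N, ∏ p ∈ n.primeFactors, (p : ℝ)⁻¹ := by
        refine Finset.sum_congr rfl fun n hn => ?_
        conv_lhs =>
          rw [← Nat.prod_primeFactors_of_squarefree (mem_squarefreeWithFactors.mp hn).2.1]
        rw [Nat.cast_prod, Finset.prod_inv_distrib]
    _ = ∑ t ∈ (squarefreeWithFactors P N).image Nat.primeFactors, ∏ p ∈ t, (p : ℝ)⁻¹ :=
        (Finset.sum_image hinj (f := fun t : Finset ℕ => ∏ p ∈ t, (p : ℝ)⁻¹)).symm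
    _ ≤ _ := by
        refine Finset.sum_le_sum_of_subset_of_nonneg ?_ fun t _ _ => by positivity
        intro t ht
        obtain ⟨n, hn, rfl⟩ := Finset.mem_image.mp ht
        obtain ⟨⟨h1, hN⟩, -, hP⟩ := mem_squarefreeWithFactors.mp hn
        refine Finset.mem_powerset.mpr fun p hp => ?_
        have hp' := Nat.prime_of_mem_primeFactors hp
        have hd := Nat.dvd_of_mem_primeFactors hp
        exact Finset.mem_filter.mpr
          ⟨Nat.mem_primesLE.mpr ⟨(Nat.le_of_dvd h1 hd).trans hN, hp'⟩, hP p hp' hd⟩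

lemma sum_log_squarefreeWithFactors_le (P : ℕ → Prop) {x : ℝ} (hx : 0 ≤ x) :
    ∑ n ∈ squarefreeWithFactors P ⌊x⌋₊, Real.log n ≤
      ∑ m ∈ squarefreeWithFactors P ⌊x⌋₊, Chebyshev.theta (x / m) := by
  calc ∑ n ∈ squarefreeWithFactors P ⌊x⌋₊, Real.log n
      = ∑ n ∈ squarefreeWithFactors P ⌊x⌋₊, ∑ p ∈ n.primeFactors, Real.log p := by
        refine Finset.sum_congr rfl fun n hn => ?_
        conv_lhs =>
          rw [← Nat.prod_primeFactors_of_squarefree (mem_squarefreeWithFactors.mp hn).2.1]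
        rw [Nat.cast_prod, Real.log_prod]
        intro p hp
        exact_mod_cast (Nat.prime_of_mem_primeFactors hp).ne_zero
    _ = ∑ a ∈ (squarefreeWithFactors P ⌊x⌋₊).sigma fun n => n.primeFactors,
          Real.log a.2 :=
        Finset.sum_sigma' _ _ _
    _ ≤ ∑ a ∈ (squarefreeWithFactors P ⌊x⌋₊).sigma fun m => ⌊x / m⌋₊.primesLE,
          Real.log a.2 := by
        have hinj : Set.InjOn (fun a : (_ : ℕ) × ℕ => (⟨a.1 / a.2, a.2⟩ : (_ : ℕ) × ℕ))
            ((squarefreeWithFactors P ⌊x⌋₊).sigma fun n => n.primeFactors : Set _) := by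
          rintro ⟨m, p⟩ hm ⟨n, q⟩ hn h
          simp only [Finset.mem_coe, Finset.mem_sigma] at hm hn
          simp only [Sigma.mk.injEq, heq_eq_eq] at h
          obtain ⟨h, rfl⟩ := h
          rw [← Nat.div_mul_cancel (Nat.dvd_of_mem_primeFactors hm.2), h,
            Nat.div_mul_cancel (Nat.dvd_of_mem_primeFactors hn.2)]
        rw [← Finset.sum_image hinj (f := fun a : (_ : ℕ) × ℕ => Real.log a.2)]
        refine Finset.sum_le_sum_of_subset_of_nonneg ?_
          fun a _ _ => Real.log_natCast_nonneg _
        intro b hb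
        obtain ⟨⟨n, p⟩, ha, rfl⟩ := Finset.mem_image.mp hb
        simp only [Finset.mem_sigma] at ha ⊢
        obtain ⟨hn, hpn⟩ := ha
        obtain ⟨⟨h1, hN⟩, hsq, hP⟩ := mem_squarefreeWithFactors.mp hn
        have hp := Nat.prime_of_mem_primeFactors hpn
        obtain ⟨m, rfl⟩ := Nat.dvd_of_mem_primeFactors hpn
        rw [Nat.mul_div_cancel_left m hp.pos]
        have hm : 0 < m := Nat.pos_of_mul_pos_left h1
        refine ⟨mem_squarefreeWithFactors.mpr
          ⟨⟨hm, (Nat.le_mul_of_pos_left m hp.pos).trans hN⟩, hsq.of_mul_right,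
            fun q hq hqm => hP q hq (hqm.mul_left p)⟩,
          Nat.mem_primesLE.mpr ⟨Nat.le_floor ?_, hp⟩⟩
        rw [le_div_iff₀ (by exact_mod_cast hm)]
        exact_mod_cast (Nat.le_floor_iff hx).mp hN
    _ = ∑ m ∈ squarefreeWithFactors P ⌊x⌋₊, Chebyshev.theta (x / m) := by
        simp_rw [Chebyshev.theta_eq_sum_primesLE]
        exact (Finset.sum_sigma' _ _ fun _ p : ℕ => Real.log p).symm

lemma card_squarefreeWithFactors_mul_log_le (P : ℕ → Prop) {x : ℝ} (hx : 0 < x) :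
    (squarefreeWithFactors P ⌊x⌋₊).card * Real.log x ≤
      (Real.log 4 + 1) * x * ∑ n ∈ squarefreeWithFactors P ⌊x⌋₊, (n : ℝ)⁻¹ := by
  have hsplit : (squarefreeWithFactors P ⌊x⌋₊).card * Real.log x =
      ∑ n ∈ squarefreeWithFactors P ⌊x⌋₊, Real.log n +
        ∑ n ∈ squarefreeWithFactors P ⌊x⌋₊, Real.log (x / n) := by
    rw [← Finset.sum_add_distrib, ← nsmul_eq_mul, ← Finset.sum_const]
    refine Finset.sum_congr rfl fun n hn => ?_
    have h1 : (n : ℝ) ≠ 0 := by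
      exact_mod_cast Nat.ne_of_gt (mem_squarefreeWithFactors.mp hn).1.1
    rw [Real.log_div hx.ne' h1]; ring
  rw [hsplit, Finset.mul_sum]
  refine (add_le_add_left (sum_log_squarefreeWithFactors_le P hx.le) _).trans ?_
  rw [← Finset.sum_add_distrib]
  refine Finset.sum_le_sum fun n hn => ?_
  have h1 : (0 : ℝ) < n := by exact_mod_cast (mem_squarefreeWithFactors.mp hn).1.1
  have h2 : 0 < x / n := by positivity
  have h3 := Chebyshev.theta_le_log4_mul_x h2.le
  have h4 := Real.log_le_self h2.le
  rw [div_eq_mul_inv] at *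
  linarith

/-- A prime that neither splits nor is inert divides the discriminant. -/
lemma dvd_discr_of_not_split_of_not_inert (K : Type*) [Field K] [NumberField K] {p : ℕ}
    (hp : p.Prime) (hs : ¬ RatPrimeSplits K p) (hi : ¬ RatPrimeInert K p) :
    (p : ℤ) ∣ NumberField.discr K := by
  have hpZ : Prime (p : ℤ) := Nat.prime_iff_prime_int.mp hp
  by_contra hd
  have hur := (NumberField.not_dvd_discr_iff_forall_mem K (𝓞 K) hpZ).mp hd
  have hp0 : (p : 𝓞 K) ≠ 0 := by exact_mod_cast hp.ne_zero
  have hcomap : ∀ Q : Ideal (𝓞 K), Q.IsPrime → (p : 𝓞 K) ∈ Q →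
      Q.comap (algebraMap ℤ (𝓞 K)) = Ideal.span {(p : ℤ)} := fun Q hQ hpQ =>
    ((Ideal.liesOver_span_iff hQ.ne_top hpZ).mpr (by simpa using hpQ)).over.symm
  have hbot : ∀ Q : Ideal (𝓞 K), (p : 𝓞 K) ∈ Q → Q ≠ ⊥ := by
    rintro Q hQ rfl
    exact hp0 (by simpa using hQ)
  have huniq : ∀ Q Q' : Ideal (𝓞 K), Q.IsPrime → Q'.IsPrime → (p : 𝓞 K) ∈ Q → (p : 𝓞 K) ∈ Q' →
      Q = Q' := fun Q Q' h h' hm hm' => by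
    by_contra hne
    exact hs ⟨Q, Q', hne, h, h', hbot Q hm, hbot Q' hm', hcomap Q h hm, hcomap Q' h' hm'⟩
  have hmax : (Ideal.span {(p : ℤ)}).IsMaximal := hpZ.isMaximal_span_singleton
  obtain ⟨⟨Q, hQprime, hQover⟩⟩ := (Ideal.span {(p : ℤ)}).nonempty_primesOver (S := 𝓞 K)
  have hpQ : (p : 𝓞 K) ∈ Q := by
    simpa using (Ideal.liesOver_span_iff hQprime.ne_top hpZ).mp hQover
  have hQ : Ideal.span {(p : 𝓞 K)} ≤ Q := (Ideal.span_singleton_le_iff_mem Q).mpr hpQ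
  obtain ⟨J, hJ⟩ := Ideal.dvd_iff_le.mpr hQ
  by_cases hJt : J = ⊤
  · apply hi
    rw [RatPrimeInert, hJ, hJt, Ideal.mul_top]
    exact hQprime
  obtain ⟨M, hMmax, hM⟩ := Ideal.exists_le_maximal _ hJt
  have hpM : (p : 𝓞 K) ∈ M :=
    hM ((hJ.le.trans Ideal.mul_le_right) (Ideal.mem_span_singleton_self _))
  obtain rfl := huniq M Q hMmax.isPrime hQprime hpM hpQ
  have := hMmax.isPrime
  have hun : Algebra.IsUnramifiedAt ℤ M := hur M hMmax.isPrime (by simpa using hpQ)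
  refine not_dvd_differentIdeal_iff.mpr hun ?_
  have h := pow_sub_one_dvd_differentIdeal ℤ (p := Ideal.span {(p : ℤ)}) M 2
    (by simpa using hp.ne_zero) (by
      rw [Ideal.map_span, Set.image_singleton, map_natCast, hJ, pow_two]
      exact mul_dvd_mul_left _ (Ideal.dvd_iff_le.mpr hM))
  simpa using h

open Classical in
lemma local_factor_le (K : Type*) [Field K] [NumberField K] {p : ℕ} (hp : p.Prime) :
    (if ¬ RatPrimeSplits K p then 1 + (p : ℝ)⁻¹ else 1) ≤
      √(1 - (p : ℝ)⁻¹)⁻¹ * √(1 - sK K p / p) *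
        (if p ∣ (NumberField.discr K).natAbs then √(1 - (p : ℝ)⁻¹)⁻¹ else 1) := by
  have hp2 : (2 : ℝ) ≤ p := by exact_mod_cast hp.two_le
  have ht0 : 0 < (p : ℝ)⁻¹ := by positivity
  have ht : (p : ℝ)⁻¹ ≤ 1 / 2 := by
    rw [one_div]; exact inv_anti₀ (by norm_num) hp2
  simp only [div_eq_mul_inv, sK]
  set t := (p : ℝ)⁻¹
  have h1 : 0 < 1 - t := by linarith
  have hsq : 1 ≤ √(1 - t)⁻¹ := Real.one_le_sqrt.mpr ((one_le_inv₀ h1).mpr (by linarith))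
  have hlast : 1 ≤ if p ∣ (NumberField.discr K).natAbs then √(1 - t)⁻¹ else 1 := by
    split_ifs
    exacts [hsq, le_rfl]
  by_cases hs : RatPrimeSplits K p
  · simp only [hs, not_true_eq_false, if_false, if_true]
    rw [← Real.sqrt_mul (by positivity), one_mul, inv_mul_cancel₀ h1.ne', Real.sqrt_one, one_mul]
    exact hlast
  · simp only [hs, not_false_eq_true, if_true, if_false]
    by_cases hi : RatPrimeInert K p
    · simp only [hi, if_true]
      refine le_trans ?_ (le_mul_of_one_le_right (by positivity) hlast)
      rw [← Real.sqrt_mul (by positivity)]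
      refine Real.le_sqrt_of_sq_le ?_
      rw [inv_mul_eq_div, le_div_iff₀ h1]
      nlinarith [mul_pos ht0 ht0]
    · have hd := Int.natCast_dvd.mp (dvd_discr_of_not_split_of_not_inert K hp hs hi)
      simp only [hi, hd, if_true, if_false, zero_mul, sub_zero, Real.sqrt_one, mul_one]
      rw [Real.mul_self_sqrt (by positivity), ← one_div, le_div_iff₀ h1]
      nlinarith [mul_pos ht0 ht0]

lemma prod_sqrt_ite_dvd_le {n : ℕ} (hn : n ≠ 0) (N : ℕ) :
    ∏ p ∈ N.primesLE, (if p ∣ n then √(1 - (p : ℝ)⁻¹)⁻¹ else 1) ≤ √(n / n.totient) := by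
  have hφ : (n.totient : ℝ) = n * ∏ p ∈ n.primeFactors, (1 - (p : ℝ)⁻¹) := by
    have h := congrArg (Rat.cast : ℚ → ℝ) (Nat.totient_eq_mul_prod_factors n)
    push_cast at h
    exact h
  have hpos : ∀ p : ℕ, p.Prime → 0 < 1 - (p : ℝ)⁻¹ := fun p hp =>
    sub_pos.mpr (inv_lt_one_of_one_lt₀ (by exact_mod_cast hp.one_lt))
  have hn0 : (n : ℝ) ≠ 0 := by exact_mod_cast hn
  have hdiv : (n : ℝ) / n.totient = ∏ p ∈ n.primeFactors, (1 - (p : ℝ)⁻¹)⁻¹ := by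
    rw [hφ, Finset.prod_inv_distrib, div_mul_eq_div_div, div_self hn0, one_div]
  rw [hdiv, Real.sqrt_prod _ fun p hp =>
    (inv_pos.mpr (hpos p (Nat.prime_of_mem_primeFactors hp))).le, ← Finset.prod_filter]
  refine Finset.prod_le_prod_of_subset_of_one_le ?_ (fun p _ => Real.sqrt_nonneg _) fun p hp _ => ?_
  · intro p hp
    obtain ⟨hp, hd⟩ := Finset.mem_filter.mp hp
    exact Nat.mem_primeFactors.mpr ⟨Nat.prime_of_mem_primesLE hp, hd, hn⟩
  · have h := hpos p (Nat.prime_of_mem_primeFactors hp)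
    exact Real.one_le_sqrt.mpr ((one_le_inv₀ h).mpr (sub_le_self _ (by positivity)))

open Classical in
lemma prod_not_split_le (K : Type*) [Field K] [NumberField K] {x : ℝ} (hx : 3 ≤ x) :
    ∏ p ∈ ⌊x⌋₊.primesLE with ¬ RatPrimeSplits K p, (1 + (p : ℝ)⁻¹) ≤
      √(2 * Real.exp 4 * Real.log x) *
        √(|(NumberField.discr K : ℝ)| / ((NumberField.discr K).natAbs.totient : ℝ)) *
        ∏ p ∈ ⌊x⌋₊.primesLE, √(1 - sK K p / p) := by
  have hpos : ∀ p ∈ ⌊x⌋₊.primesLE, 0 ≤ (1 - (p : ℝ)⁻¹)⁻¹ := fun p hp =>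
    inv_nonneg.mpr (sub_nonneg.mpr (inv_le_one_of_one_le₀
      (by exact_mod_cast (Nat.prime_of_mem_primesLE hp).one_lt.le)))
  have habs : |(NumberField.discr K : ℝ)| = ((NumberField.discr K).natAbs : ℝ) := by
    rw [Nat.cast_natAbs, Int.cast_abs]
  calc ∏ p ∈ ⌊x⌋₊.primesLE with ¬ RatPrimeSplits K p, (1 + (p : ℝ)⁻¹)
      ≤ ∏ p ∈ ⌊x⌋₊.primesLE, (√(1 - (p : ℝ)⁻¹)⁻¹ * √(1 - sK K p / p) *
        (if p ∣ (NumberField.discr K).natAbs then √(1 - (p : ℝ)⁻¹)⁻¹ else 1)) := by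
        rw [Finset.prod_filter]
        refine Finset.prod_le_prod (fun p _ => ?_) fun p hp =>
          local_factor_le K (Nat.prime_of_mem_primesLE hp)
        split_ifs <;> positivity
    _ = √(∏ p ∈ ⌊x⌋₊.primesLE, (1 - (p : ℝ)⁻¹)⁻¹) *
          (∏ p ∈ ⌊x⌋₊.primesLE,
            (if p ∣ (NumberField.discr K).natAbs then √(1 - (p : ℝ)⁻¹)⁻¹ else 1)) *
          ∏ p ∈ ⌊x⌋₊.primesLE, √(1 - sK K p / p) := by
        rw [Finset.prod_mul_distrib, Finset.prod_mul_distrib, Real.sqrt_prod _ hpos]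
        ring
    _ ≤ _ := by
        rw [habs]
        refine mul_le_mul_of_nonneg_right (mul_le_mul
          (Real.sqrt_le_sqrt (prod_one_sub_inv_inv_le_log hx))
          (prod_sqrt_ite_dvd_le (Int.natAbs_ne_zero.mpr (NumberField.discr_ne_zero K)) _)
          (Finset.prod_nonneg fun p _ => ?_) (Real.sqrt_nonneg _))
          (Finset.prod_nonneg fun p _ => Real.sqrt_nonneg _)
        split_ifs <;> positivity

/-- Bound for the number of squarefree positive integers `n ≤ x` having no prime factor that
splits in the quadratic field `K`. -/
theorem stmt_8 :
    ∃ C : ℝ, ∀ (K : Type) [instF : Field K] [instN : NumberField K],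
      Module.finrank ℚ K = 2 →
      ∀ x : ℝ, 3 ≤ x →
      ({n : ℕ | 0 < n ∧ (n : ℝ) ≤ x ∧ Squarefree n ∧
          ∀ p : ℕ, p.Prime → p ∣ n → ¬ RatPrimeSplits K p}.ncard : ℝ) ≤
        C * (x / Real.sqrt (Real.log x)) *
          Real.sqrt ((|(NumberField.discr K : ℝ)|) /
            (Nat.totient (NumberField.discr K).natAbs : ℝ)) *
          ∏ᶠ p ∈ {p : ℕ | p.Prime ∧ (p : ℝ) ≤ x}, Real.sqrt (1 - sK K p / (p : ℝ)) := by
  refine ⟨(Real.log 4 + 1) * √(2 * Real.exp 4), ?_⟩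
  intro K _ _ _ x hx
  have hx0 : 0 < x := by linarith
  have hL : 0 < Real.log x := Real.log_pos (by linarith)
  have hset : {n : ℕ | 0 < n ∧ (n : ℝ) ≤ x ∧ Squarefree n ∧
      ∀ p : ℕ, p.Prime → p ∣ n → ¬ RatPrimeSplits K p} =
      squarefreeWithFactors (fun p => ¬ RatPrimeSplits K p) ⌊x⌋₊ := by
    ext n
    rw [Finset.mem_coe, mem_squarefreeWithFactors, Nat.le_floor_iff hx0.le, and_assoc]
    rfl
  have hprimes : {p : ℕ | p.Prime ∧ (p : ℝ) ≤ x} = ⌊x⌋₊.primesLE := by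
    ext p
    rw [Finset.mem_coe, Nat.mem_primesLE, Nat.le_floor_iff hx0.le, and_comm]
    rfl
  rw [hset, Set.ncard_coe_finset, hprimes, finprod_mem_coe_finset]
  classical
  have h := (card_squarefreeWithFactors_mul_log_le (fun p => ¬ RatPrimeSplits K p) hx0).trans
    (mul_le_mul_of_nonneg_left
      ((sum_inv_squarefreeWithFactors_le _ _).trans (prod_not_split_le K hx)) (by positivity))
  rw [← le_div_iff₀ hL] at h
  refine h.trans (le_of_eq ?_)
  have hS : √(Real.log x) ≠ 0 := (Real.sqrt_pos.mpr hL).ne'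
  rw [Real.sqrt_mul (by positivity)]
  nth_rewrite 2 [← Real.mul_self_sqrt hL.le]
  field_simp
end

section
/- There exist absolute constants C and x₀ such that for every real x ≥ x₀, every primitive quadratic Dirichlet character χ modulo q with q ≤ log x, and every real y ≥ x: |Σ_{x < p ≤ y} χ(p)/p| ≤ C, where the sum runs over rational primes p with x < p ≤ y and χ takes the real values −1, 0, 1. -/
open NumberField
open Finset

section Summation

/-- Abel's inequality: if the partial sums of `g` are nonnegative, so are those of `g * a` for
`a` nonnegative and antitone. -/
lemma sum_Ioc_mul_nonneg_of_antitoneOn {g a : ℕ → ℝ} {m : ℕ}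
    (hg : ∀ k, 0 ≤ ∑ i ∈ Ioc m k, g i) (ha : AntitoneOn a (Set.Ioi m))
    (ha0 : ∀ i, m < i → 0 ≤ a i) (n : ℕ) : 0 ≤ ∑ i ∈ Ioc m n, g i * a i := by
  have key (k : ℕ) : a (m + k + 1) * ∑ i ∈ Ioc m (m + k + 1), g i ≤
      ∑ i ∈ Ioc m (m + k + 1), g i * a i := by
    induction k with
    | zero => simp [mul_comm]
    | succ k ih =>
      rw [show m + (k + 1) + 1 = (m + k + 1) + 1 by ring, sum_Ioc_succ_top (by omega) g,
        sum_Ioc_succ_top (by omega) (fun i ↦ g i * a i), mul_add, mul_comm (a _) (g _)]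
      refine add_le_add (le_trans ?_ ih) le_rfl
      exact mul_le_mul_of_nonneg_right
        (ha (Set.mem_Ioi.2 (by omega)) (Set.mem_Ioi.2 (by omega)) (by omega)) (hg _)
  rcases le_or_gt n m with h | h
  · simp [Ioc_eq_empty_of_le h]
  · obtain ⟨k, rfl⟩ := Nat.exists_eq_add_of_lt h
    exact (mul_nonneg (ha0 _ h) (hg _)).trans (key k)

lemma sum_Ioc_mul_le_of_antitoneOn {g h a : ℕ → ℝ} {m : ℕ}
    (hgh : ∀ k, ∑ i ∈ Ioc m k, g i ≤ ∑ i ∈ Ioc m k, h i) (ha : AntitoneOn a (Set.Ioi m))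
    (ha0 : ∀ i, m < i → 0 ≤ a i) (n : ℕ) :
    ∑ i ∈ Ioc m n, g i * a i ≤ ∑ i ∈ Ioc m n, h i * a i := by
  have := sum_Ioc_mul_nonneg_of_antitoneOn (g := fun i ↦ h i - g i) (m := m)
    (fun k ↦ by simpa using hgh k) ha ha0 n
  simpa [sub_mul] using this

lemma abs_sum_Ioc_mul_le_of_antitoneOn {g a : ℕ → ℝ} {m : ℕ} {B : ℝ}
    (hg : ∀ k, |∑ i ∈ Ioc m k, g i| ≤ B) (ha : AntitoneOn a (Set.Ioi m))
    (ha0 : ∀ i, m < i → 0 ≤ a i) (n : ℕ) : |∑ i ∈ Ioc m n, g i * a i| ≤ B * a (m + 1) := by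
  have hB : 0 ≤ B := (abs_nonneg _).trans (hg 0)
  rcases le_or_gt n m with h | h
  · simpa [Ioc_eq_empty_of_le h] using mul_nonneg hB (ha0 (m + 1) (by omega))
  have hs (k : ℕ) (hk : m < k) (c : ℕ → ℝ) :
      ∑ i ∈ Ioc m k, (if i = m + 1 then c i else 0) = c (m + 1) := by
    rw [sum_ite_eq' (Ioc m k), if_pos (by simp; omega)]
  have aux (s : ℝ) (hsg : ∀ k, s * ∑ i ∈ Ioc m k, g i ≤ B) :
      s * ∑ i ∈ Ioc m n, g i * a i ≤ B * a (m + 1) := by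
    have := sum_Ioc_mul_le_of_antitoneOn (g := fun i ↦ s * g i)
      (h := fun i ↦ if i = m + 1 then B else 0) (m := m) (fun k ↦ by
        rw [← mul_sum]
        rcases le_or_gt k m with hk | hk
        · simp [Ioc_eq_empty_of_le hk]
        · exact (hsg k).trans_eq (hs k hk fun _ ↦ B).symm) ha ha0 n
    simp only [ite_mul, zero_mul, hs n h fun i ↦ B * a i] at this
    simpa [mul_sum, mul_assoc] using this
  rw [abs_le]
  have h1 := aux 1 fun k ↦ by simpa using (abs_le.1 (hg k)).2
  have h2 := aux (-1) fun k ↦ by linarith [(abs_le.1 (hg k)).1]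
  constructor <;> linarith

lemma abs_sum_Ioc_le_two_mul {g : ℕ → ℝ} {B : ℝ} (hg : ∀ k, |∑ i ∈ Ioc 0 k, g i| ≤ B) (m n : ℕ) :
    |∑ i ∈ Ioc m n, g i| ≤ 2 * B := by
  have hB : 0 ≤ B := (abs_nonneg _).trans (hg 0)
  rcases le_or_gt n m with h | h
  · simpa [Ioc_eq_empty_of_le h] using hB
  have := sum_Ioc_consecutive g (Nat.zero_le m) h.le
  have h1 := abs_le.1 (hg m)
  have h2 := abs_le.1 (hg n)
  rw [abs_le]
  constructor <;> linarith

/-- Reordering a sum over divisors. -/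
lemma sum_Ioc_sum_divisors (F : ℕ → ℕ → ℝ) (N : ℕ) :
    ∑ n ∈ Ioc 0 N, ∑ d ∈ n.divisors, F d (n / d) =
      ∑ d ∈ Ioc 0 N, ∑ k ∈ Ioc 0 (N / d), F d k := by
  rw [sum_sigma', sum_sigma']
  refine sum_bij' (fun x _ ↦ ⟨x.2, x.1 / x.2⟩) (fun x _ ↦ ⟨x.1 * x.2, x.1⟩) ?_ ?_ ?_ ?_ ?_
  · rintro ⟨n, d⟩ h
    simp only [mem_sigma, mem_Ioc, Nat.mem_divisors] at h ⊢
    have := Nat.le_of_dvd h.1.1 h.2.1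
    have hd := Nat.pos_of_dvd_of_pos h.2.1 h.1.1
    exact ⟨⟨hd, by omega⟩, Nat.div_pos this hd, Nat.div_le_div_right h.1.2⟩
  · rintro ⟨d, k⟩ h
    simp only [mem_sigma, mem_Ioc, Nat.mem_divisors] at h ⊢
    have := (Nat.le_div_iff_mul_le h.1.1).1 h.2.2
    have hp := Nat.mul_pos h.1.1 h.2.1
    exact ⟨⟨hp, by linarith⟩, ⟨k, rfl⟩, hp.ne'⟩
  · rintro ⟨n, d⟩ h
    simp only [mem_sigma, mem_Ioc, Nat.mem_divisors] at h
    simp [Nat.mul_div_cancel' h.2.1]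
  · rintro ⟨d, k⟩ h
    simp only [mem_sigma, mem_Ioc] at h
    simp [Nat.mul_div_cancel_left k h.1.1]
  · simp

lemma sum_Ioc_one_div_sqrt_le (m n : ℕ) : ∑ k ∈ Ioc m n, 1 / √(k : ℝ) ≤ 2 * √n := by
  have key : ∑ k ∈ Ioc 0 n, 1 / √(k : ℝ) ≤ 2 * √n := by
    induction n with
    | zero => simp
    | succ n ih =>
      rw [sum_Ioc_succ_top (by omega)]
      have hp : 0 < √((n + 1 : ℕ) : ℝ) := by positivity
      have h1 := Real.sq_sqrt (Nat.cast_nonneg (α := ℝ) (n + 1))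
      have h2 := Real.sq_sqrt (Nat.cast_nonneg (α := ℝ) n)
      have : 1 / √((n + 1 : ℕ) : ℝ) ≤ 2 * √((n + 1 : ℕ) : ℝ) - 2 * √n := by
        rw [div_le_iff₀ hp]
        push_cast at *
        nlinarith [sq_nonneg (√((n : ℝ) + 1) - √n)]
      linarith
  exact (sum_le_sum_of_subset_of_nonneg (Ioc_subset_Ioc_left (Nat.zero_le m))
    fun _ _ _ ↦ by positivity).trans key

lemma antitoneOn_one_div_sqrt : AntitoneOn (fun k : ℕ ↦ 1 / √(k : ℝ)) (Set.Ioi 0) := by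
  intro a ha b _ hab
  have : 0 < a := ha
  dsimp only
  gcongr

end Summation
section PolyaVinogradov

open ZMod

lemma dft_apply_of_isPrimitive_of_sq_eq_one {q : ℕ} [NeZero q] {χ : DirichletCharacter ℂ q}
    (h2 : χ ^ 2 = 1) (hχ : χ.IsPrimitive) (i : ZMod q) :
    (q : ℂ) * χ i = gaussSum χ stdAddChar * 𝓕 (χ : ZMod q → ℂ) i := by
  have hinv : χ⁻¹ = χ := by rw [inv_eq_iff_mul_eq_one, ← sq, h2]
  have h1 : 𝓕 (χ : ZMod q → ℂ) = gaussSum χ stdAddChar • fun k ↦ χ (-k) := by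
    ext k
    rw [hχ.fourierTransform_eq_inv_mul_gaussSum, hinv, Pi.smul_apply, smul_eq_mul, mul_comm]
  have h3 := congrFun (dft_dft (χ : ZMod q → ℂ)) (-i)
  rw [h1, _root_.map_smul, dft_comp_neg] at h3
  simpa using h3.symm

lemma norm_gaussSum_of_isPrimitive_of_sq_eq_one {q : ℕ} [NeZero q] {χ : DirichletCharacter ℂ q}
    (h2 : χ ^ 2 = 1) (hχ : χ.IsPrimitive) : ‖gaussSum χ stdAddChar‖ = √q := by
  have h3 := dft_apply_of_isPrimitive_of_sq_eq_one h2 hχ (-1)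
  have hinv : χ⁻¹ = χ := by rw [inv_eq_iff_mul_eq_one, ← sq, h2]
  rw [hχ.fourierTransform_eq_inv_mul_gaussSum, hinv, neg_neg, map_one, one_mul] at h3
  rw [← Real.sqrt_sq (norm_nonneg _), sq, ← norm_mul, ← h3, norm_mul]
  have : ‖χ (-1)‖ = 1 := by
    simpa using DirichletCharacter.unit_norm_eq_one χ (-1)
  simp [this]

lemma one_div_sin_pi_mul_div_le {k q : ℕ} (hk : 0 < k) (hkq : k < q) :
    0 < Real.sin (Real.pi * k / q) ∧
      1 / Real.sin (Real.pi * k / q) ≤ q / 2 * (1 / (k : ℝ) + 1 / ((q - k : ℕ) : ℝ)) := by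
  have key (j : ℕ) (hj : 0 < j) (hjq : 2 * j ≤ q) : 0 < Real.sin (Real.pi * j / q) ∧
      1 / Real.sin (Real.pi * j / q) ≤ q / 2 * (1 / (j : ℝ)) := by
    have hq : (0 : ℝ) < q := by norm_cast; omega
    have hj' : (0 : ℝ) < j := by exact_mod_cast hj
    have hjq' : (2 : ℝ) * j ≤ q := by exact_mod_cast hjq
    have := Real.mul_le_sin (x := Real.pi * j / q) (by positivity) (by
      rw [div_le_div_iff₀ hq two_pos]
      nlinarith [Real.pi_pos])
    have h1 : 2 / Real.pi * (Real.pi * j / q) = 2 * j / q := by field_simp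
    rw [h1] at this
    have h0 : 0 < 2 * (j : ℝ) / q := by positivity
    refine ⟨h0.trans_le this, (one_div_le_one_div_of_le h0 this).trans_eq ?_⟩
    field_simp
  have hq : (0 : ℝ) < q := by norm_cast; omega
  rcases le_total (2 * k) q with h | h
  · refine ⟨(key k hk h).1, (key k hk h).2.trans ?_⟩
    gcongr
    simp
  · have h1 := key (q - k) (by omega) (by omega)
    have h2 : Real.sin (Real.pi * (q - k : ℕ) / q) = Real.sin (Real.pi * k / q) := by
      rw [← Real.sin_pi_sub]
      congr 1
      rw [Nat.cast_sub hkq.le]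
      field_simp
      ring
    rw [h2] at h1
    refine ⟨h1.1, h1.2.trans ?_⟩
    gcongr
    simp

lemma norm_sum_range_stdAddChar_le {q : ℕ} [NeZero q] {k : ℕ} (hk : 0 < k) (hkq : k < q) (n : ℕ) :
    ‖∑ i ∈ range n, stdAddChar (-((k : ZMod q) * (i : ZMod q)))‖ ≤
      q / 2 * (1 / (k : ℝ) + 1 / ((q - k : ℕ) : ℝ)) := by
  set z : ℂ := stdAddChar (-(k : ZMod q)) with hz
  have hsum : ∑ i ∈ range n, stdAddChar (-((k : ZMod q) * (i : ZMod q))) =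
      ∑ i ∈ range n, z ^ i := by
    refine sum_congr rfl fun i _ ↦ ?_
    rw [hz, ← AddChar.map_nsmul_eq_pow]
    congr 1
    simp [mul_comm]
  have hzn : ‖z‖ = 1 := by
    rw [hz, stdAddChar_apply]
    exact Circle.norm_coe _
  have hz1 : ‖z - 1‖ = 2 * Real.sin (Real.pi * k / q) := by
    have : z = Complex.exp (Complex.I * ((-(2 * Real.pi * k / q) : ℝ) : ℂ)) := by
      have h := stdAddChar_coe (N := q) (-(k : ℤ))
      push_cast at h
      rw [hz, h]
      congr 1
      push_cast
      ring
    rw [this, Complex.norm_exp_I_mul_ofReal_sub_one]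
    rw [show -(2 * Real.pi * k / q) / 2 = -(Real.pi * k / q) by ring, Real.sin_neg]
    rw [norm_mul, norm_neg, Real.norm_of_nonneg (one_div_sin_pi_mul_div_le hk hkq).1.le]
    simp
  obtain ⟨hs, hs'⟩ := one_div_sin_pi_mul_div_le hk hkq
  refine le_trans ?_ hs'
  rw [hsum, le_div_iff₀ hs]
  have := congrArg norm (geom_sum_mul z n)
  rw [norm_mul, hz1] at this
  have h2 : ‖z ^ n - 1‖ ≤ 2 := by
    refine (norm_sub_le _ _).trans ?_
    rw [norm_pow, hzn]
    norm_num
  linarith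

lemma sum_zmod_eq_sum_range {q : ℕ} [NeZero q] {E : Type*} [AddCommMonoid E] (F : ZMod q → E) :
    ∑ j, F j = ∑ k ∈ range q, F k := by
  refine sum_nbij' ZMod.val (fun k ↦ (k : ZMod q)) ?_ ?_ ?_ ?_ ?_
  · simp [ZMod.val_lt]
  · simp
  · simp
  · intro k hk
    exact ZMod.val_cast_of_lt (mem_range.1 hk)
  · simp

/-- The Pólya–Vinogradov inequality for primitive quadratic characters. -/
lemma norm_sum_range_le_of_isPrimitive {q : ℕ} [NeZero q] {χ : DirichletCharacter ℂ q}
    (h2 : χ ^ 2 = 1) (h1 : χ ≠ 1) (hχ : χ.IsPrimitive) (n : ℕ) :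
    ‖∑ i ∈ range n, χ i‖ ≤ √q * (1 + Real.log q) := by
  have hq1 : q ≠ 1 := by
    rintro rfl
    exact h1 (DirichletCharacter.level_one χ)
  have hq0 : q ≠ 0 := NeZero.ne q
  have hq : (0 : ℝ) < q := by positivity
  have hχ0 : χ 0 = 0 := by
    have : Nontrivial (ZMod q) := ZMod.nontrivial_iff.2 hq1
    exact χ.map_nonunit not_isUnit_zero
  have hexp : (q : ℂ) * ∑ i ∈ range n, χ i = gaussSum χ stdAddChar *
      ∑ k ∈ Ioo 0 q, (∑ i ∈ range n, stdAddChar (-((k : ZMod q) * (i : ZMod q)))) * χ k := by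
    rw [mul_sum]
    simp_rw [dft_apply_of_isPrimitive_of_sq_eq_one h2 hχ, dft_apply, smul_eq_mul]
    rw [← mul_sum, sum_comm, sum_zmod_eq_sum_range]
    simp_rw [← sum_mul]
    rw [range_eq_Ico, ← sum_sdiff (Ioo_subset_Ico_self (a := 0) (b := q)), Ico_sdiff_Ioo_self]
    · simp [hχ0]
    · omega
  have hb : ‖∑ k ∈ Ioo 0 q, (∑ i ∈ range n, stdAddChar (-((k : ZMod q) * (i : ZMod q)))) * χ k‖ ≤
      q * (1 + Real.log q) := by
    have hh : ∑ k ∈ Ioo 0 q, 1 / (k : ℝ) ≤ 1 + Real.log q := by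
      have := harmonic_le_one_add_log q
      refine le_trans ?_ this
      rw [harmonic_eq_sum_Icc]
      push_cast
      simp only [one_div]
      refine sum_le_sum_of_subset_of_nonneg (fun k hk ↦ ?_) fun _ _ _ ↦ by positivity
      simp only [mem_Ioo, mem_Icc] at hk ⊢
      omega
    have hh' : ∑ k ∈ Ioo 0 q, 1 / ((q - k : ℕ) : ℝ) = ∑ k ∈ Ioo 0 q, 1 / (k : ℝ) := by
      refine sum_nbij' (fun k ↦ q - k) (fun k ↦ q - k) ?_ ?_ ?_ ?_ ?_ <;>
      · intro k hk
        simp only [mem_Ioo] at hk ⊢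
        try omega
    calc _ ≤ ∑ k ∈ Ioo 0 q, (q : ℝ) / 2 * (1 / (k : ℝ) + 1 / ((q - k : ℕ) : ℝ)) := by
            refine norm_sum_le_of_le _ fun k hk ↦ ?_
            rw [mem_Ioo] at hk
            rw [norm_mul]
            refine le_trans (mul_le_of_le_one_right (norm_nonneg _) (χ.norm_le_one _)) ?_
            exact norm_sum_range_stdAddChar_le hk.1 hk.2 n
      _ ≤ q * (1 + Real.log q) := by
            rw [← mul_sum, sum_add_distrib, hh']
            nlinarith
  have := congrArg norm hexp
  rw [norm_mul, norm_mul, norm_gaussSum_of_isPrimitive_of_sq_eq_one h2 hχ, Complex.norm_natCast]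
    at this
  have h3 : (q : ℝ) * ‖∑ i ∈ range n, χ i‖ ≤ q * (√q * (1 + Real.log q)) := by
    rw [this]
    nlinarith [mul_le_mul_of_nonneg_left hb (Real.sqrt_nonneg q)]
  exact le_of_mul_le_mul_left h3 hq

end PolyaVinogradov

section BoundedPartialSums

variable {f : ℕ → ℝ} {M : ℝ}

lemma abs_sum_Ioc_div_sqrt_le (hf : ∀ n, |f n| ≤ 1) (hM : 1 ≤ M)
    (hfM : ∀ n, |∑ i ∈ Ioc 0 n, f i| ≤ M) (m n : ℕ) :
    |∑ k ∈ Ioc m n, f k * (1 / √(k : ℝ))| ≤ 4 * √M := by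
  have hM0 : 0 < M := by linarith
  have hlow (m n : ℕ) (hn : (n : ℝ) ≤ M) :
      |∑ k ∈ Ioc m n, f k * (1 / √(k : ℝ))| ≤ 2 * √M := by
    refine (abs_sum_le_sum_abs _ _).trans ?_
    have : 2 * √(n : ℝ) ≤ 2 * √M := by gcongr
    refine le_trans (sum_le_sum fun k _ ↦ ?_) ((sum_Ioc_one_div_sqrt_le m n).trans this)
    rw [abs_mul, abs_of_nonneg (by positivity : 0 ≤ 1 / √(k : ℝ))]
    exact mul_le_of_le_one_left (by positivity) (hf k)
  have hhigh (m n : ℕ) (hm : M ≤ (m + 1 : ℕ)) :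
      |∑ k ∈ Ioc m n, f k * (1 / √(k : ℝ))| ≤ 2 * √M := by
    refine (abs_sum_Ioc_mul_le_of_antitoneOn (abs_sum_Ioc_le_two_mul hfM m)
      (antitoneOn_one_div_sqrt.mono (Set.Ioi_subset_Ioi (Nat.zero_le m)))
      (fun _ _ ↦ by positivity) n).trans ?_
    calc 2 * M * (1 / √((m + 1 : ℕ) : ℝ)) ≤ 2 * M * (1 / √M) := by gcongr
      _ = 2 * √M := by
        field_simp
        rw [Real.sq_sqrt hM0.le]
  have hpos : 0 ≤ √M := Real.sqrt_nonneg M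
  rcases le_or_gt (n : ℝ) M with hn | hn
  · linarith [hlow m n hn]
  rcases le_or_gt M ((m + 1 : ℕ) : ℝ) with hm | hm
  · linarith [hhigh m n hm]
  have hmK : m ≤ ⌊M⌋₊ := Nat.le_floor (by push_cast at hm; linarith)
  have hKn : ⌊M⌋₊ ≤ n := Nat.floor_le_of_le hn.le
  rw [← sum_Ioc_consecutive _ hmK hKn]
  have h1 := hlow m _ (Nat.floor_le hM0.le)
  have h2 := hhigh ⌊M⌋₊ n (by push_cast; exact (Nat.lt_floor_add_one M).le)
  linarith [abs_add_le (∑ k ∈ Ioc m ⌊M⌋₊, f k * (1 / √(k : ℝ)))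
    (∑ k ∈ Ioc ⌊M⌋₊ n, f k * (1 / √(k : ℝ)))]

lemma abs_sum_Ioc_div_le (hf : ∀ n, |f n| ≤ 1) (hM : 1 ≤ M)
    (hfM : ∀ n, |∑ i ∈ Ioc 0 n, f i| ≤ M) (m n : ℕ) :
    |∑ k ∈ Ioc m n, f k / k| ≤ 4 * √M / √(m + 1) := by
  have := abs_sum_Ioc_mul_le_of_antitoneOn (abs_sum_Ioc_div_sqrt_le hf hM hfM m)
      (antitoneOn_one_div_sqrt.mono (Set.Ioi_subset_Ioi (Nat.zero_le m)))
      (fun _ _ ↦ by positivity) n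
  push_cast at this
  rw [mul_one_div] at this
  refine le_of_eq_of_le ?_ this
  congr 1
  refine sum_congr rfl fun k _ ↦ ?_
  rw [mul_assoc, one_div_mul_one_div, Real.mul_self_sqrt (Nat.cast_nonneg k), mul_one_div]

lemma abs_sum_Ioc_mul_log_div_le (hf : ∀ n, |f n| ≤ 1) (hM : 1 ≤ M)
    (hfM : ∀ n, |∑ i ∈ Ioc 0 n, f i| ≤ M) (n : ℕ) :
    |∑ k ∈ Ioc 0 n, f k * Real.log k / k| ≤ 16 * √M := by
  have hM1 : 1 ≤ √M := Real.one_le_sqrt.2 hM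
  have hlow (n : ℕ) (hn : n ≤ 8) : |∑ k ∈ Ioc 0 n, f k * Real.log k / k| ≤ 8 := by
    refine (abs_sum_le_sum_abs _ _).trans ?_
    refine (sum_le_card_nsmul _ _ 1 fun k hk ↦ ?_).trans (by simpa using hn)
    have hk : 0 < k := (mem_Ioc.1 hk).1
    have hk' : (0 : ℝ) < k := by exact_mod_cast hk
    rw [abs_div, abs_mul, Nat.abs_cast, div_le_one hk', abs_of_nonneg (Real.log_natCast_nonneg k)]
    exact (mul_le_of_le_one_left (Real.log_natCast_nonneg k) (hf k)).trans
      (Real.log_le_self hk'.le)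
  rcases le_total n 8 with hn | hn
  · linarith [hlow n hn]
  have hanti : AntitoneOn (fun k : ℕ ↦ Real.log k / √(k : ℝ)) (Set.Ioi 8) := by
    have h8 {k : ℕ} (hk : 8 < k) : Real.exp 2 ≤ k := by
      have h1 := Real.exp_one_lt_d9
      have h2 : Real.exp 2 = Real.exp 1 * Real.exp 1 := by rw [← Real.exp_add]; norm_num
      have h3 : (8 : ℝ) < k := by exact_mod_cast hk
      nlinarith [Real.exp_pos 1]
    intro a ha b hb hab
    exact Real.log_div_sqrt_antitoneOn (h8 ha) (h8 hb) (by exact_mod_cast hab)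
  have hhigh := abs_sum_Ioc_mul_le_of_antitoneOn (abs_sum_Ioc_div_sqrt_le hf hM hfM 8) hanti
    (fun k _ ↦ div_nonneg (Real.log_natCast_nonneg k) (Real.sqrt_nonneg _)) n
  have h9 (t : ℝ) (ht : 0 < t) : Real.log t / √t ≤ 2 := by
    rw [div_le_iff₀ (by positivity)]
    have h := Real.log_le_self (Real.sqrt_nonneg t)
    rw [Real.log_sqrt ht.le] at h
    linarith
  have heq : ∑ k ∈ Ioc 8 n, f k * Real.log k / k =
      ∑ k ∈ Ioc 8 n, f k * (1 / √(k : ℝ)) * (Real.log k / √(k : ℝ)) := by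
    refine sum_congr rfl fun k _ ↦ ?_
    rw [mul_one_div, div_mul_div_comm, Real.mul_self_sqrt (Nat.cast_nonneg k)]
  rw [← sum_Ioc_consecutive _ (Nat.zero_le 8) hn]
  have h1 := hlow 8 le_rfl
  rw [← heq] at hhigh
  have h2 : 4 * √M * (Real.log ((8 + 1 : ℕ) : ℝ) / √((8 + 1 : ℕ) : ℝ)) ≤ 4 * √M * 2 := by
    gcongr
    exact h9 _ (by positivity)
  linarith [abs_add_le (∑ k ∈ Ioc 0 8, f k * Real.log k / k)
    (∑ k ∈ Ioc 8 n, f k * Real.log k / k)]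

lemma exists_abs_sum_Ioc_div_sub_le (hf : ∀ n, |f n| ≤ 1) (hM : 1 ≤ M)
    (hfM : ∀ n, |∑ i ∈ Ioc 0 n, f i| ≤ M) :
    ∃ L : ℝ, ∀ n : ℕ, |L - ∑ k ∈ Ioc 0 n, f k / k| ≤ 4 * √M / √(n + 1) := by
  have hdist (n m : ℕ) (h : n ≤ m) :
      dist (∑ k ∈ Ioc 0 m, f k / k) (∑ k ∈ Ioc 0 n, f k / k) ≤ 4 * √M / √(n + 1) := by
    rw [Real.dist_eq, ← sum_Ioc_consecutive _ (Nat.zero_le n) h, add_sub_cancel_left]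
    exact abs_sum_Ioc_div_le hf hM hfM n m
  have hlim : Filter.Tendsto (fun n : ℕ ↦ 4 * √M / √((n : ℝ) + 1)) Filter.atTop (nhds 0) := by
    refine Filter.Tendsto.const_div_atTop ?_ _
    exact Real.tendsto_sqrt_atTop.comp
      (Filter.tendsto_atTop_add_const_right _ _ tendsto_natCast_atTop_atTop)
  have hc : CauchySeq fun n ↦ ∑ k ∈ Ioc 0 n, f k / k :=
    cauchySeq_of_le_tendsto_0' (fun n : ℕ ↦ 4 * √M / √((n : ℝ) + 1))
      (fun n m h ↦ by rw [dist_comm]; exact hdist n m h) hlim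
  obtain ⟨L, hL⟩ := cauchySeq_tendsto_of_complete hc
  refine ⟨L, fun n ↦ ?_⟩
  refine le_of_tendsto ((hL.sub_const _).abs) ?_
  filter_upwards [Filter.eventually_ge_atTop n] with m hm
  exact hdist n m hm

end BoundedPartialSums

section Chebyshev

open ArithmeticFunction Chebyshev

lemma sum_Ioc_vonMangoldt_div_sqrt_le (n : ℕ) :
    ∑ d ∈ Ioc 0 n, vonMangoldt d * (1 / √(d : ℝ)) ≤ 12 * √n := by
  have hlog : Real.log 4 ≤ 2 := by
    have := Real.log_two_lt_d9
    rw [show (4 : ℝ) = 2 ^ 2 by norm_num, Real.log_pow]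
    push_cast
    linarith
  have h := sum_Ioc_mul_le_of_antitoneOn (g := fun d ↦ vonMangoldt d) (h := fun _ ↦ 6) (m := 0)
    (fun k ↦ by
      have h := psi_le_const_mul_self (Nat.cast_nonneg (α := ℝ) k)
      rw [psi, Nat.floor_natCast] at h
      refine h.trans ?_
      rw [sum_const, Nat.card_Ioc, nsmul_eq_mul, Nat.sub_zero, mul_comm]
      gcongr
      linarith) antitoneOn_one_div_sqrt (fun _ _ ↦ by positivity) n
  rw [← mul_sum] at h
  linarith [sum_Ioc_one_div_sqrt_le 0 n]

/-- Prime powers contribute a bounded amount to the sum of `Λ n / n`. -/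
lemma exists_sum_Ioc_vonMangoldt_not_prime_div_le :
    ∃ C : ℝ, 0 ≤ C ∧ ∀ n : ℕ, ∑ d ∈ Ioc 0 n with ¬ d.Prime, vonMangoldt d / d ≤ C := by
  obtain ⟨C, hC⟩ := psi_sub_theta_le_mul_sqrt
  have hC0 : 0 ≤ C := by
    have := hC 1
    rw [psi_one, theta_one] at this
    simpa using this
  have hanti : AntitoneOn (fun k : ℕ ↦ 1 / (k : ℝ)) (Set.Ioi 0) := by
    intro a ha b _ hab
    have : 0 < a := ha
    dsimp only
    gcongr
  have hsum : Summable fun k : ℕ ↦ 1 / √(k : ℝ) * (1 / k) := by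
    refine (Real.summable_one_div_nat_rpow.2 (by norm_num : (1 : ℝ) < 3 / 2)).congr fun k ↦ ?_
    rcases k.eq_zero_or_pos with rfl | hk
    · norm_num
    have hk : (0 : ℝ) < k := by exact_mod_cast hk
    rw [one_div_mul_one_div, Real.sqrt_eq_rpow]
    nth_rw 3 [← Real.rpow_one (k : ℝ)]
    rw [← Real.rpow_add hk]
    norm_num
  refine ⟨C * ∑' k : ℕ, 1 / √(k : ℝ) * (1 / k),
    mul_nonneg hC0 (tsum_nonneg fun _ ↦ by positivity), fun n ↦ ?_⟩
  have h := sum_Ioc_mul_le_of_antitoneOn (g := fun d ↦ if ¬ d.Prime then vonMangoldt d else 0)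
    (h := fun k ↦ C * (1 / √(k : ℝ))) (m := 0) (fun k ↦ by
      have h := hC k
      rw [psi_sub_theta_eq_sum_not_prime, Nat.floor_natCast, sum_filter] at h
      refine h.trans ?_
      rw [← mul_sum]
      gcongr
      calc √(k : ℝ) = ∑ i ∈ Ioc 0 k, 1 / √(k : ℝ) := by
            rw [sum_const, Nat.card_Ioc, nsmul_eq_mul, Nat.sub_zero, mul_one_div, Real.div_sqrt]
        _ ≤ _ := sum_le_sum fun i hi ↦ antitoneOn_one_div_sqrt (mem_Ioc.1 hi).1
            ((mem_Ioc.1 hi).1.trans_le (mem_Ioc.1 hi).2) (mem_Ioc.1 hi).2) hanti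
            (fun _ _ ↦ by positivity) n
  calc _ = ∑ d ∈ Ioc 0 n, (if ¬ d.Prime then vonMangoldt d else 0) * (1 / (d : ℝ)) := by
        rw [sum_filter]
        refine sum_congr rfl fun d _ ↦ ?_
        split_ifs <;> simp [div_eq_mul_inv]
    _ ≤ _ := h
    _ ≤ _ := by
      simp_rw [mul_assoc]
      rw [← mul_sum]
      gcongr
      exact hsum.sum_le_tsum _ fun _ _ ↦ by positivity

end Chebyshev

section MultiplicativeFunction

variable {f : ℕ → ℝ} {M : ℝ}

lemma abs_mul_sum_Ioc_mul_vonMangoldt_div_le (hmul : ∀ a b, f (a * b) = f a * f b)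
    (hf : ∀ n, |f n| ≤ 1) (hM : 1 ≤ M) (hfM : ∀ n, |∑ i ∈ Ioc 0 n, f i| ≤ M) {L : ℝ}
    (hL : ∀ n : ℕ, |L - ∑ k ∈ Ioc 0 n, f k / k| ≤ 4 * √M / √(n + 1)) (N : ℕ) :
    |L * ∑ d ∈ Ioc 0 N, f d * ArithmeticFunction.vonMangoldt d / d| ≤ 64 * √M := by
  have hpos : 0 ≤ √M := Real.sqrt_nonneg M
  rcases N.eq_zero_or_pos with rfl | hN
  · simp
  have hN' : (0 : ℝ) < N := by exact_mod_cast hN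
  have hconv : ∑ n ∈ Ioc 0 N, f n * Real.log n / n =
      ∑ d ∈ Ioc 0 N, f d * ArithmeticFunction.vonMangoldt d / d *
        ∑ k ∈ Ioc 0 (N / d), f k / k := by
    simp_rw [mul_sum]
    rw [← sum_Ioc_sum_divisors
      fun d k ↦ f d * ArithmeticFunction.vonMangoldt d / d * (f k / k)]
    refine sum_congr rfl fun n hn ↦ ?_
    rw [← ArithmeticFunction.vonMangoldt_sum, mul_sum, sum_div]
    refine sum_congr rfl fun d hd ↦ ?_
    have h := Nat.mul_div_cancel' (Nat.dvd_of_mem_divisors hd)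
    nth_rw 1 2 [← h]
    rw [hmul]
    push_cast
    ring
  have herr : |∑ d ∈ Ioc 0 N, f d * ArithmeticFunction.vonMangoldt d / d *
      (L - ∑ k ∈ Ioc 0 (N / d), f k / k)| ≤ 48 * √M := by
    refine (abs_sum_le_sum_abs _ _).trans ?_
    calc _ ≤ ∑ d ∈ Ioc 0 N, 4 * √M / √N *
          (ArithmeticFunction.vonMangoldt d * (1 / √(d : ℝ))) := by
          refine sum_le_sum fun d hd ↦ ?_
          have hd0 : 0 < d := (mem_Ioc.1 hd).1
          have hd' : (0 : ℝ) < d := by exact_mod_cast hd0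
          have hΛ := ArithmeticFunction.vonMangoldt_nonneg (n := d)
          have h1 : |f d * ArithmeticFunction.vonMangoldt d / d| ≤
              ArithmeticFunction.vonMangoldt d / d := by
            rw [abs_div, abs_mul, Nat.abs_cast, abs_of_nonneg hΛ]
            gcongr
            exact mul_le_of_le_one_left hΛ (hf d)
          have h2 : 4 * √M / √((N / d : ℕ) + 1) ≤ 4 * √M / √(N / d) := by
            gcongr
            rw [div_le_iff₀ hd']
            exact_mod_cast (Nat.lt_div_mul_add (a := N) hd0).le.trans_eq (by ring)
          rw [abs_mul]
          refine (mul_le_mul h1 ((hL _).trans h2) (abs_nonneg _) (by positivity)).trans_eq ?_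
          rw [Real.sqrt_div hN'.le]
          have h3 := Real.mul_self_sqrt hd'.le
          have h4 : √(d : ℝ) ≠ 0 := by positivity
          field_simp
          rw [sq, h3]
      _ ≤ 4 * √M / √N * (12 * √N) := by
          rw [← mul_sum]
          gcongr
          exact sum_Ioc_vonMangoldt_div_sqrt_le N
      _ = 48 * √M := by
          field_simp
          ring
  have heq : L * ∑ d ∈ Ioc 0 N, f d * ArithmeticFunction.vonMangoldt d / d =
      ∑ n ∈ Ioc 0 N, f n * Real.log n / n +
      ∑ d ∈ Ioc 0 N, f d * ArithmeticFunction.vonMangoldt d / d *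
        (L - ∑ k ∈ Ioc 0 (N / d), f k / k) := by
    rw [hconv, ← sum_add_distrib, mul_sum]
    exact sum_congr rfl fun d _ ↦ by ring
  rw [heq]
  linarith [abs_sum_Ioc_mul_log_div_le hf hM hfM N, abs_add_le (∑ n ∈ Ioc 0 N, f n * Real.log n / n)
    (∑ d ∈ Ioc 0 N, f d * ArithmeticFunction.vonMangoldt d / d *
      (L - ∑ k ∈ Ioc 0 (N / d), f k / k))]

lemma mul_sqrt_pow_le_geom_sum {x : ℝ} (hx : 0 ≤ x) (n : ℕ) :
    (n + 1) * √x ^ n ≤ ∑ i ∈ range (n + 1), x ^ i := by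
  induction n using Nat.twoStepInduction with
  | zero => simp
  | one =>
    have := Real.sq_sqrt hx
    simp only [sum_range_succ, sum_range_zero]
    push_cast
    nlinarith [sq_nonneg (√x - 1)]
  | more n ih _ =>
    rw [geom_sum_succ', geom_sum_succ, ← Real.sq_sqrt hx, Real.sqrt_sq (Real.sqrt_nonneg x)]
    rw [← Real.sq_sqrt hx, Real.sqrt_sq (Real.sqrt_nonneg x)] at ih
    push_cast
    have h1 : √x ^ (n + 2) = √x ^ 2 * √x ^ n := by ring
    have h2 := mul_le_mul_of_nonneg_left ih (sq_nonneg √x)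
    have h3 : (√x ^ 2) ^ (n + 1 + 1) = (√x ^ (n + 2)) ^ 2 := by ring
    rw [h3]
    nlinarith [sq_nonneg (√x ^ (n + 2) - 1)]

lemma antitoneOn_one_div_sub_pow_div_geom_sum {x : ℝ} (hx : 0 ≤ x) (hx1 : x ≤ 1) :
    AntitoneOn (fun d : ℕ ↦ 1 / (d : ℝ) - x ^ d / ∑ i ∈ range d, x ^ i) (Set.Ioi 0) := by
  refine antitoneOn_of_add_one_le Set.ordConnected_Ioi fun d _ hd _ ↦ ?_
  obtain ⟨n, rfl⟩ : ∃ n, d = n + 1 := ⟨d - 1, by have : 0 < d := hd; omega⟩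
  have h1 := mul_sqrt_pow_le_geom_sum hx n
  have h2 := mul_sqrt_pow_le_geom_sum hx (n + 1)
  have hs : √x ≤ 1 := Real.sqrt_le_one.2 hx1
  have hpos (m : ℕ) : 0 < ∑ i ∈ range (m + 1), x ^ i := geom_sum_pos hx m.succ_ne_zero
  have h12 := mul_le_mul h1 h2 (by positivity) (hpos n).le
  have h3 : x ^ (n + 1) ≤ √x ^ n * √x ^ (n + 1) := by
    calc x ^ (n + 1) = √x ^ n * √x ^ (n + 1) * √x := by
          nth_rw 1 [← Real.sq_sqrt hx]
          ring
      _ ≤ _ := mul_le_of_le_one_right (by positivity) hs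
  have h4 : x ^ (n + 1) / (∑ i ∈ range (n + 1), x ^ i) -
      x ^ (n + 1 + 1) / (∑ i ∈ range (n + 1 + 1), x ^ i) =
      x ^ (n + 1) / ((∑ i ∈ range (n + 1), x ^ i) * ∑ i ∈ range (n + 1 + 1), x ^ i) := by
    rw [div_sub_div _ _ (hpos n).ne' (hpos (n + 1)).ne', geom_sum_succ (n := n + 1)]
    congr 1
    ring
  have h5 : 1 / ((n + 1 : ℕ) : ℝ) - 1 / ((n + 1 + 1 : ℕ) : ℝ) =
      1 / (((n : ℝ) + 1) * (n + 1 + 1)) := by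
    push_cast
    field_simp
    ring
  have h6 : x ^ (n + 1) / ((∑ i ∈ range (n + 1), x ^ i) * ∑ i ∈ range (n + 1 + 1), x ^ i) ≤
      1 / (((n : ℝ) + 1) * (n + 1 + 1)) := by
    rw [div_le_div_iff₀ (mul_pos (hpos n) (hpos (n + 1))) (by positivity)]
    push_cast at h12
    nlinarith [mul_le_mul_of_nonneg_left h3
      (by positivity : 0 ≤ ((n : ℝ) + 1) * (n + 1 + 1))]
  linarith

lemma one_div_sub_pow_div_geom_sum_nonneg {x : ℝ} (hx : 0 ≤ x) (hx1 : x ≤ 1) {d : ℕ} (hd : 0 < d) :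
    0 ≤ 1 / (d : ℝ) - x ^ d / ∑ i ∈ range d, x ^ i := by
  rw [sub_nonneg, div_le_div_iff₀ (geom_sum_pos hx hd.ne') (by exact_mod_cast hd), one_mul]
  calc x ^ d * d = ∑ i ∈ range d, x ^ d := by simp [mul_comm]
    _ ≤ _ := sum_le_sum fun i hi ↦ pow_le_pow_of_le_one hx hx1 (mem_range.1 hi).le

/-- A truncated Lambert series. -/
lemma abs_pow_div_geom_sum_sub_le {x : ℝ} (hx : 0 ≤ x) (hx1 : x < 1) {d N : ℕ} (hd : 0 < d) :
    |x ^ d / ∑ i ∈ range d, x ^ i - (1 - x) * ∑ k ∈ Ioc 0 (N / d), x ^ (d * k)| ≤ x ^ N := by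
  have hS : 0 < ∑ i ∈ range d, x ^ i := geom_sum_pos hx hd.ne'
  have h1 := geom_sum_mul x d
  have h2 : (∑ k ∈ Ioc 0 (N / d), x ^ (d * k)) * (x ^ d - 1) = x ^ (d * (N / d + 1)) - x ^ d := by
    generalize N / d = K
    induction K with
    | zero => simp
    | succ K ih =>
      rw [sum_Ioc_succ_top (by omega), add_mul, ih]
      ring
  have h3 : x ^ d / ∑ i ∈ range d, x ^ i - (1 - x) * ∑ k ∈ Ioc 0 (N / d), x ^ (d * k) =
      x ^ (d * (N / d + 1)) / ∑ i ∈ range d, x ^ i := by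
    rw [eq_div_iff hS.ne', sub_mul, div_mul_cancel₀ _ hS.ne']
    linear_combination (∑ k ∈ Ioc 0 (N / d), x ^ (d * k)) * h1 + h2
  rw [h3, abs_of_nonneg (by positivity)]
  have h4 : 1 ≤ ∑ i ∈ range d, x ^ i := by
    obtain ⟨n, rfl⟩ : ∃ n, d = n + 1 := ⟨d - 1, by omega⟩
    rw [geom_sum_succ]
    have : 0 ≤ x * ∑ i ∈ range n, x ^ i := mul_nonneg hx (sum_nonneg fun _ _ ↦ by positivity)
    linarith
  refine (div_le_self (by positivity) h4).trans (pow_le_pow_of_le_one hx hx1.le ?_)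
  rw [mul_add_one]
  exact (Nat.lt_mul_div_succ N hd).le

lemma le_sum_Ioc_div (hf : ∀ n, |f n| ≤ 1) (hfM : ∀ n, |∑ i ∈ Ioc 0 n, f i| ≤ M)
    (hr : ∀ n : ℕ, 0 ≤ ∑ d ∈ n.divisors, f d)
    (hr1 : ∀ m : ℕ, 0 < m → 1 ≤ ∑ d ∈ (m ^ 2).divisors, f d)
    {x : ℝ} (hx : 0 ≤ x) (hx1 : x < 1) {J N : ℕ} (hJN : J ^ 2 ≤ N) :
    (1 - x) * (J * x ^ J ^ 2 - M) - N * x ^ N ≤ ∑ d ∈ Ioc 0 N, f d / d := by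
  have h1 : (J : ℝ) * x ^ J ^ 2 ≤ ∑ n ∈ Ioc 0 N, (∑ d ∈ n.divisors, f d) * x ^ n := by
    calc (J : ℝ) * x ^ J ^ 2 = ∑ m ∈ Ioc 0 J, x ^ J ^ 2 := by simp
      _ ≤ ∑ m ∈ Ioc 0 J, (∑ d ∈ (m ^ 2).divisors, f d) * x ^ m ^ 2 := by
          refine sum_le_sum fun m hm ↦ ?_
          rw [mem_Ioc] at hm
          have := pow_le_pow_of_le_one hx hx1.le (Nat.pow_le_pow_left hm.2 2)
          exact this.trans (le_mul_of_one_le_left (by positivity) (hr1 m hm.1))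
      _ = ∑ n ∈ (Ioc 0 J).image (· ^ 2), (∑ d ∈ n.divisors, f d) * x ^ n := by
          rw [sum_image]
          exact fun a _ b _ h ↦ Nat.pow_left_injective two_ne_zero h
      _ ≤ _ := by
          refine sum_le_sum_of_subset_of_nonneg ?_ fun n _ _ ↦ mul_nonneg (hr n) (by positivity)
          intro n hn
          obtain ⟨m, hm, rfl⟩ := mem_image.1 hn
          rw [mem_Ioc] at hm ⊢
          exact ⟨pow_pos hm.1 2, (Nat.pow_le_pow_left hm.2 2).trans hJN⟩
  have h2 : ∑ n ∈ Ioc 0 N, (∑ d ∈ n.divisors, f d) * x ^ n =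
      ∑ d ∈ Ioc 0 N, f d * ∑ k ∈ Ioc 0 (N / d), x ^ (d * k) := by
    simp_rw [mul_sum]
    rw [← sum_Ioc_sum_divisors fun d k ↦ f d * x ^ (d * k)]
    refine sum_congr rfl fun n _ ↦ ?_
    rw [sum_mul]
    refine sum_congr rfl fun d hd ↦ ?_
    rw [Nat.mul_div_cancel' (Nat.dvd_of_mem_divisors hd)]
  have h3 := abs_sum_Ioc_mul_le_of_antitoneOn hfM
    (antitoneOn_one_div_sub_pow_div_geom_sum hx hx1.le)
    (fun d hd ↦ one_div_sub_pow_div_geom_sum_nonneg hx hx1.le hd) N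
  have h4 : |∑ d ∈ Ioc 0 N, f d * (x ^ d / ∑ i ∈ range d, x ^ i -
      (1 - x) * ∑ k ∈ Ioc 0 (N / d), x ^ (d * k))| ≤ N * x ^ N := by
    refine (abs_sum_le_sum_abs _ _).trans ((sum_le_card_nsmul _ _ (x ^ N) fun d hd ↦ ?_).trans_eq
      (by simp))
    rw [abs_mul]
    exact (mul_le_of_le_one_left (abs_nonneg _) (hf d)).trans
      (abs_pow_div_geom_sum_sub_le hx hx1 (mem_Ioc.1 hd).1)
  have h5 : ∑ d ∈ Ioc 0 N, f d / d =
      ∑ d ∈ Ioc 0 N, f d * (1 / (d : ℝ) - x ^ d / ∑ i ∈ range d, x ^ i) +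
      ∑ d ∈ Ioc 0 N, f d * (x ^ d / ∑ i ∈ range d, x ^ i -
        (1 - x) * ∑ k ∈ Ioc 0 (N / d), x ^ (d * k)) +
      (1 - x) * ∑ d ∈ Ioc 0 N, f d * ∑ k ∈ Ioc 0 (N / d), x ^ (d * k) := by
    rw [mul_sum, ← sum_add_distrib, ← sum_add_distrib]
    exact sum_congr rfl fun d _ ↦ by ring
  simp only [zero_add, Nat.cast_one, div_one, pow_one, range_one, sum_singleton, pow_zero] at h3
  rw [h5, ← h2]
  have h6 := mul_le_mul_of_nonneg_left h1 (sub_nonneg.2 hx1.le)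
  linarith [(abs_le.1 h3).1, (abs_le.1 h4).1]

lemma one_div_le_of_abs_sub_sum_Ioc_div_le (hf : ∀ n, |f n| ≤ 1) (hM : 1 ≤ M)
    (hfM : ∀ n, |∑ i ∈ Ioc 0 n, f i| ≤ M)
    (hr : ∀ n : ℕ, 0 ≤ ∑ d ∈ n.divisors, f d)
    (hr1 : ∀ m : ℕ, 0 < m → 1 ≤ ∑ d ∈ (m ^ 2).divisors, f d)
    {L : ℝ} (hL : ∀ n : ℕ, |L - ∑ k ∈ Ioc 0 n, f k / k| ≤ 4 * √M / √(n + 1)) :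
    1 / (50 * M) ≤ L := by
  have hlim : Filter.Tendsto (fun n : ℕ ↦ 4 * √M / √((n : ℝ) + 1)) Filter.atTop (nhds 0) := by
    refine Filter.Tendsto.const_div_atTop ?_ _
    exact Real.tendsto_sqrt_atTop.comp
      (Filter.tendsto_atTop_add_const_right _ _ tendsto_natCast_atTop_atTop)
  obtain ⟨J, hJ, hJ'⟩ : ∃ J : ℕ, 4 * M ≤ J ∧ (J : ℝ) ≤ 5 * M :=
    ⟨⌈4 * M⌉₊, Nat.le_ceil _, by linarith [Nat.ceil_lt_add_one (by linarith : 0 ≤ 4 * M)]⟩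
  have hJ1 : (1 : ℝ) ≤ J := by linarith
  have hJ2 : (1 : ℝ) ≤ J ^ 2 := one_le_pow₀ hJ1
  set x : ℝ := 1 - 1 / (2 * J ^ 2) with hxdef
  have hsmall : 1 / (2 * (J : ℝ) ^ 2) ≤ 1 / 2 := by
    gcongr
    linarith
  have hpos : 0 < 1 / (2 * (J : ℝ) ^ 2) := by positivity
  have hx : 0 ≤ x := by linarith
  have hx1 : x < 1 := by linarith
  have hxJ : 1 / 2 ≤ x ^ J ^ 2 := by
    have h := one_add_mul_le_pow (by linarith : -2 ≤ -(1 / (2 * (J : ℝ) ^ 2))) (J ^ 2)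
    rw [← sub_eq_add_neg, ← hxdef] at h
    refine le_trans (le_of_eq ?_) h
    push_cast
    field_simp
    norm_num
  have hbound (N : ℕ) (hN : J ^ 2 ≤ N) :
      1 / (2 * (J : ℝ) ^ 2) * M ≤ L + (N * x ^ N + 4 * √M / √((N : ℝ) + 1)) := by
    have h1 := le_sum_Ioc_div hf hfM hr hr1 hx hx1 hN
    have h2 := (abs_le.1 (hL N)).1
    have h3 : M ≤ J * x ^ J ^ 2 - M := by nlinarith
    have h4 : 1 - x = 1 / (2 * (J : ℝ) ^ 2) := by rw [hxdef]; ring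
    have h5 := mul_le_mul_of_nonneg_left h3 hpos.le
    rw [h4] at h1
    linarith
  have hlim2 : Filter.Tendsto
      (fun N : ℕ ↦ L + (N * x ^ N + 4 * √M / √((N : ℝ) + 1))) Filter.atTop (nhds L) := by
    simpa using ((tendsto_self_mul_const_pow_of_lt_one hx hx1).add hlim).const_add L
  have hle : 1 / (2 * (J : ℝ) ^ 2) * M ≤ L :=
    ge_of_tendsto hlim2 (Filter.eventually_atTop.2 ⟨J ^ 2, hbound⟩)
  refine le_trans ?_ hle
  have hM0 : 0 < M := by linarith
  rw [div_mul_eq_mul_div, one_mul, div_le_div_iff₀ (by positivity) (by positivity)]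
  nlinarith [pow_le_pow_left₀ (by linarith) hJ' 2]

end MultiplicativeFunction

section QuadraticCharacter

variable {q : ℕ} {χ : DirichletCharacter ℝ q}

lemma sum_divisors_prime_pow_nonneg (h2 : χ ^ 2 = 1) {p : ℕ} (hp : p.Prime) (k : ℕ) :
    0 ≤ ∑ d ∈ (p ^ k).divisors, χ d := by
  rw [Nat.sum_divisors_prime_pow hp]
  push_cast
  simp only [map_pow]
  rcases MulChar.isQuadratic_iff_sq_eq_one.mpr h2 p with h | h | h
  · exact sum_nonneg fun i _ ↦ by simp [h]
  · exact sum_nonneg fun i _ ↦ by simp [h]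
  · rw [h, neg_one_geom_sum]
    split_ifs <;> simp

lemma one_le_sum_divisors_prime_pow (h2 : χ ^ 2 = 1) {p : ℕ} (hp : p.Prime) {k : ℕ}
    (hk : Even k) : 1 ≤ ∑ d ∈ (p ^ k).divisors, χ d := by
  rw [Nat.sum_divisors_prime_pow hp]
  push_cast
  simp only [map_pow]
  rcases MulChar.isQuadratic_iff_sq_eq_one.mpr h2 p with h | h | h
  · simp [h, sum_range_succ']
  · simp [h]
  · rw [h, neg_one_geom_sum, if_neg (by simpa [Nat.even_add_one] using hk)]

open ArithmeticFunction in
lemma sum_divisors_eq_factorization_prod (χ : DirichletCharacter ℝ q) {n : ℕ} (hn : n ≠ 0) :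
    ∑ d ∈ n.divisors, χ d = n.factorization.prod fun p k ↦ ∑ d ∈ (p ^ k).divisors, χ d := by
  have h (m : ℕ) : ∑ d ∈ m.divisors, χ d =
      ((zeta : ArithmeticFunction ℝ) * toArithmeticFunction (χ ·)) m := by
    rw [coe_zeta_mul_apply]
    exact sum_congr rfl fun d hd ↦
      χ.apply_eq_toArithmeticFunction_apply (Nat.pos_of_mem_divisors hd).ne'
  simp_rw [h]
  exact (isMultiplicative_zeta.natCast.mul
    χ.isMultiplicative_toArithmeticFunction).multiplicative_factorization _ hn

lemma sum_divisors_nonneg (h2 : χ ^ 2 = 1) (n : ℕ) : 0 ≤ ∑ d ∈ n.divisors, χ d := by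
  rcases eq_or_ne n 0 with rfl | hn
  · simp
  rw [sum_divisors_eq_factorization_prod χ hn]
  exact prod_nonneg fun p hp ↦
    sum_divisors_prime_pow_nonneg h2 (Nat.prime_of_mem_primeFactors hp) _

lemma one_le_sum_divisors_sq (h2 : χ ^ 2 = 1) {m : ℕ} (hm : 0 < m) :
    1 ≤ ∑ d ∈ (m ^ 2).divisors, χ d := by
  rw [sum_divisors_eq_factorization_prod χ (by positivity)]
  refine Finset.one_le_prod fun p hp ↦
    one_le_sum_divisors_prime_pow h2 (Nat.prime_of_mem_primeFactors hp) ?_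
  simp

lemma isPrimitive_ringHomComp_of_injective [NeZero q] {R S : Type*} [CommRing R] [CommRing S]
    {χ : DirichletCharacter R q} (hχ : χ.IsPrimitive) {φ : R →+* S}
    (hφ : Function.Injective φ) :
    DirichletCharacter.IsPrimitive (MulChar.ringHomComp χ φ) := by
  have hset : DirichletCharacter.conductorSet (MulChar.ringHomComp χ φ) = χ.conductorSet := by
    ext d
    simp only [DirichletCharacter.mem_conductorSet_iff]
    have hker (hd : d ∣ q) :
        DirichletCharacter.FactorsThrough (MulChar.ringHomComp χ φ) d ↔ χ.FactorsThrough d := by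
      rw [DirichletCharacter.factorsThrough_iff_ker_unitsMap hd,
        DirichletCharacter.factorsThrough_iff_ker_unitsMap hd]
      have : (MulChar.toUnitHom (MulChar.ringHomComp χ φ)).ker = (MulChar.toUnitHom χ).ker := by
        ext u
        simp [MonoidHom.mem_ker, Units.ext_iff, map_eq_one_iff φ hφ]
      rw [this]
    exact ⟨fun h ↦ (hker h.dvd).1 h, fun h ↦ (hker h.dvd).2 h⟩
  rw [DirichletCharacter.isPrimitive_def, DirichletCharacter.conductor, hset]
  exact hχ

lemma abs_sum_Ioc_le_of_isPrimitive [NeZero q] (h2 : χ ^ 2 = 1) (h1 : χ ≠ 1)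
    (hχ : χ.IsPrimitive) (n : ℕ) : |∑ i ∈ Ioc 0 n, χ i| ≤ √q * (1 + Real.log q) := by
  have hinj : Function.Injective Complex.ofRealHom := Complex.ofReal_injective
  have h2' : (MulChar.ringHomComp χ Complex.ofRealHom) ^ 2 = 1 := by
    rw [MulChar.ringHomComp_pow, h2, MulChar.ringHomComp_one]
  have h1' : MulChar.ringHomComp χ Complex.ofRealHom ≠ 1 :=
    (MulChar.ringHomComp_ne_one_iff hinj).2 h1
  have h := norm_sum_range_le_of_isPrimitive h2' h1'
    (isPrimitive_ringHomComp_of_injective hχ hinj) (n + 1)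
  have hq1 : q ≠ 1 := by
    rintro rfl
    exact h1 (DirichletCharacter.level_one χ)
  have hχ0 : χ 0 = 0 := by
    have : Nontrivial (ZMod q) := ZMod.nontrivial_iff.2 hq1
    exact χ.map_nonunit not_isUnit_zero
  have heq : ∑ i ∈ range (n + 1), MulChar.ringHomComp χ Complex.ofRealHom i =
      ((∑ i ∈ Ioc 0 n, χ i : ℝ) : ℂ) := by
    rw [range_eq_Ico, sum_eq_sum_Ico_succ_bot n.succ_pos]
    simp only [MulChar.ringHomComp_apply, Complex.ofRealHom_eq_coe, Nat.cast_zero, hχ0,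
      Complex.ofReal_zero, zero_add, Complex.ofReal_sum]
    rfl
  rwa [heq, Complex.norm_real] at h

lemma abs_apply_le_one (h2 : χ ^ 2 = 1) (a : ZMod q) : |χ a| ≤ 1 := by
  rcases MulChar.isQuadratic_iff_sq_eq_one.mpr h2 a with h | h | h <;> simp [h]

lemma exists_abs_sum_Ioc_mul_vonMangoldt_div_le :
    ∃ C : ℝ, ∀ (q : ℕ) [NeZero q] (χ : DirichletCharacter ℝ q),
      χ ^ 2 = 1 → χ ≠ 1 → χ.IsPrimitive → ∀ n : ℕ,
      |∑ d ∈ Ioc 0 n, χ d * ArithmeticFunction.vonMangoldt d / d| ≤ C * q := by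
  refine ⟨57600, fun q _ χ h2 h1 hχ n ↦ ?_⟩
  have hq0 : 0 < q := Nat.pos_of_ne_zero (NeZero.ne q)
  have hq : (1 : ℝ) ≤ q := by exact_mod_cast hq0
  obtain ⟨s, hs1, hs⟩ : ∃ s : ℝ, 1 ≤ s ∧ s ^ 6 = q := by
    refine ⟨(q : ℝ) ^ (1 / 6 : ℝ), Real.one_le_rpow hq (by norm_num), ?_⟩
    rw [← Real.rpow_natCast, ← Real.rpow_mul (by positivity)]
    norm_num
  have hs0 : 0 < s := by linarith
  have hM : 1 ≤ 6 * s ^ 4 := by linarith [one_le_pow₀ hs1 (n := 4)]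
  have hf (n : ℕ) : |χ n| ≤ 1 := abs_apply_le_one h2 _
  have hfM (n : ℕ) : |∑ i ∈ Ioc 0 n, χ i| ≤ 6 * s ^ 4 := by
    refine (abs_sum_Ioc_le_of_isPrimitive h2 h1 hχ n).trans ?_
    have hsq : √(q : ℝ) = s ^ 3 := by
      rw [← hs, show s ^ 6 = (s ^ 3) ^ 2 by ring, Real.sqrt_sq (by positivity)]
    have hlog : 1 + Real.log q ≤ 6 * s := by
      rw [← hs, Real.log_pow]
      push_cast
      linarith [Real.log_le_sub_one_of_pos hs0]
    rw [hsq]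
    calc s ^ 3 * (1 + Real.log q) ≤ s ^ 3 * (6 * s) := by gcongr
      _ = 6 * s ^ 4 := by ring
  obtain ⟨L, hL⟩ := exists_abs_sum_Ioc_div_sub_le hf hM hfM
  have hLlow := one_div_le_of_abs_sub_sum_Ioc_div_le hf hM hfM (sum_divisors_nonneg h2)
    (fun m hm ↦ one_le_sum_divisors_sq h2 hm) hL
  have hT := abs_mul_sum_Ioc_mul_vonMangoldt_div_le (fun a b ↦ by simp) hf hM hfM hL n
  have hsqrt : √(6 * s ^ 4) ≤ 3 * s ^ 2 := by
    refine Real.sqrt_le_iff.2 ⟨by positivity, ?_⟩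
    nlinarith [pow_pos hs0 4]
  set T := |∑ d ∈ Ioc 0 n, χ d * ArithmeticFunction.vonMangoldt d / d| with hTdef
  have hT0 : 0 ≤ T := abs_nonneg _
  rw [abs_mul, abs_of_nonneg (le_trans (by positivity) hLlow), ← hTdef] at hT
  have h3 : 1 / (50 * (6 * s ^ 4)) * T ≤ 64 * (3 * s ^ 2) :=
    (mul_le_mul_of_nonneg_right hLlow hT0).trans (hT.trans (by gcongr))
  rw [div_mul_eq_mul_div, one_mul, div_le_iff₀ (by positivity)] at h3
  rw [← hs]
  linarith

lemma exists_abs_sum_Ioc_prime_mul_log_div_le :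
    ∃ C : ℝ, 0 ≤ C ∧ ∀ (q : ℕ) [NeZero q] (χ : DirichletCharacter ℝ q),
      χ ^ 2 = 1 → χ ≠ 1 → χ.IsPrimitive → ∀ n : ℕ,
      |∑ p ∈ Ioc 0 n, if p.Prime then χ p * Real.log p / p else 0| ≤ C * q := by
  obtain ⟨C, hC⟩ := exists_abs_sum_Ioc_mul_vonMangoldt_div_le
  obtain ⟨C', hC'0, hC'⟩ := exists_sum_Ioc_vonMangoldt_not_prime_div_le
  refine ⟨|C| + C', by positivity, fun q _ χ h2 h1 hχ n ↦ ?_⟩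
  have hq : (1 : ℝ) ≤ q := by exact_mod_cast Nat.pos_of_ne_zero (NeZero.ne q)
  have hsplit : ∑ d ∈ Ioc 0 n, χ d * ArithmeticFunction.vonMangoldt d / d =
      (∑ p ∈ Ioc 0 n, if p.Prime then χ p * Real.log p / p else 0) +
      ∑ d ∈ Ioc 0 n with ¬ d.Prime, χ d * ArithmeticFunction.vonMangoldt d / d := by
    rw [← sum_filter_add_sum_filter_not (Ioc 0 n) Nat.Prime, sum_filter]
    congr 1
    refine sum_congr rfl fun p _ ↦ ?_
    split_ifs with hp
    · rw [ArithmeticFunction.vonMangoldt_apply_prime hp]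
    · rfl
  have hnp : |∑ d ∈ Ioc 0 n with ¬ d.Prime, χ d * ArithmeticFunction.vonMangoldt d / d| ≤ C' := by
    refine (abs_sum_le_sum_abs _ _).trans ((sum_le_sum fun d _ ↦ ?_).trans (hC' n))
    have hΛ := ArithmeticFunction.vonMangoldt_nonneg (n := d)
    rw [abs_div, abs_mul, Nat.abs_cast, abs_of_nonneg hΛ]
    gcongr
    exact mul_le_of_le_one_left hΛ (abs_apply_le_one h2 _)
  have h := hC q χ h2 h1 hχ n
  have h4 : C * q ≤ |C| * q := by gcongr; exact le_abs_self C
  have h5 : C' ≤ C' * q := le_mul_of_one_le_right hC'0 hq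
  rw [hsplit] at h
  rw [abs_le] at h hnp ⊢
  constructor <;> linarith

end QuadraticCharacter

/-- For `x` large, `χ` a primitive quadratic Dirichlet character of modulus `q ≤ log x`, and any
`y ≥ x`, the tail sum `∑_{x < p ≤ y} χ(p)/p` over primes is bounded by an absolute constant. -/
theorem stmt_10 :
    ∃ C x₀ : ℝ, ∀ x : ℝ, x₀ ≤ x →
      ∀ (q : ℕ) [NeZero q] (χ : DirichletCharacter ℝ q),
        χ ^ 2 = 1 → χ ≠ 1 → χ.IsPrimitive → (q : ℝ) ≤ Real.log x →
        ∀ y : ℝ, x ≤ y →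
        |∑ᶠ p ∈ {p : ℕ | p.Prime ∧ x < (p : ℝ) ∧ (p : ℝ) ≤ y},
          χ (p : ZMod q) / (p : ℝ)| ≤ C := by
  obtain ⟨C, hC0, hC⟩ := exists_abs_sum_Ioc_prime_mul_log_div_le
  refine ⟨2 * C, 3, fun x hx q _ χ h2 h1 hχ hq y hxy ↦ ?_⟩
  have hset : {p : ℕ | p.Prime ∧ x < (p : ℝ) ∧ (p : ℝ) ≤ y} =
      ((Ioc ⌊x⌋₊ ⌊y⌋₊).filter Nat.Prime : Finset ℕ) := by
    ext p
    simp only [Set.mem_ofPred_eq, coe_filter, mem_Ioc, Nat.floor_lt (by linarith : 0 ≤ x),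
      Nat.le_floor_iff (by linarith : 0 ≤ y)]
    tauto
  have hm : 3 ≤ ⌊x⌋₊ := Nat.le_floor (by exact_mod_cast hx)
  have hlogpos {i : ℕ} (hi : ⌊x⌋₊ < i) : 0 < Real.log i :=
    Real.log_pos (by exact_mod_cast (by omega : 1 < i))
  have hanti : AntitoneOn (fun i : ℕ ↦ 1 / Real.log i) (Set.Ioi ⌊x⌋₊) := by
    intro a ha b _ hab
    have ha' : ⌊x⌋₊ < a := ha
    have ha0 : (0 : ℝ) < a := by exact_mod_cast (by omega : 0 < a)
    have := hlogpos ha'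
    dsimp only
    gcongr
  rw [hset, finsum_mem_coe_finset, sum_filter]
  have habel := abs_sum_Ioc_mul_le_of_antitoneOn
    (abs_sum_Ioc_le_two_mul (hC q χ h2 h1 hχ) ⌊x⌋₊) hanti
    (fun i hi ↦ (one_div_pos.2 (hlogpos hi)).le) ⌊y⌋₊
  have heq : ∑ p ∈ Ioc ⌊x⌋₊ ⌊y⌋₊, (if p.Prime then χ p / (p : ℝ) else 0) =
      ∑ p ∈ Ioc ⌊x⌋₊ ⌊y⌋₊,
        (if p.Prime then χ p * Real.log p / p else 0) * (1 / Real.log p) := by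
    refine sum_congr rfl fun p hp ↦ ?_
    have := (hlogpos (mem_Ioc.1 hp).1).ne'
    split_ifs
    · field_simp
    · simp
  rw [heq]
  refine habel.trans ?_
  have hlog : (q : ℝ) ≤ Real.log ((⌊x⌋₊ + 1 : ℕ) : ℝ) := by
    refine hq.trans (Real.log_le_log (by linarith) ?_)
    push_cast
    exact (Nat.lt_floor_add_one x).le
  rw [mul_one_div, div_le_iff₀ (hlogpos (Nat.lt_succ_self _))]
  nlinarith
end
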